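/- arXiv:1305.3850 — 5 statements merged into one kernel-verified Lean document; each statement's English description precedes it below -/
import Mathlib

section
/- Let q ∈ ((1+√5)/2, q_{ℵ₀}). Then there exists x ∈ (0, 1/(q−1)) such that Σ_q(x) is uncountable, there exists x ∈ (0, 1/(q−1)) with a unique q-expansion, and moreover for every x ∈ (0, 1/(q−1)) the set Σ_q(x) is either uncountable or a singleton. -/
noncomputable section

open Set

/-- The map `T_{q,i}(x) = q*x - i` for a binary digit `i`. -/
def Tmap (q : ℝ) (i : Fin 2) (x : ℝ) : ℝ := q * x - ((i : ℕ) : ℝ)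

/-- The value `((ε_i)_{i=1}^∞)_q = ∑_{i=1}^∞ ε_i q^{-i}` of a binary sequence in base `q`
(the sequence is 0-indexed, so digit `ε i` has weight `q^{-(i+1)}`). -/
def seqVal (q : ℝ) (ε : ℕ → Fin 2) : ℝ := ∑' i : ℕ, ((ε i : ℕ) : ℝ) / q ^ (i + 1)

/-- `Σ_q(x)`: the set of `q`-expansions of `x`. -/
def SigmaSet (q x : ℝ) : Set (ℕ → Fin 2) := {ε | x = seqVal q ε}

/-- The interval `I_q = [0, 1/(q-1)]`. -/
def Iq (q : ℝ) : Set ℝ := Icc 0 (1 / (q - 1))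

/-- The switch region `S_q = [1/q, 1/(q(q-1))]`. -/
def Sq (q : ℝ) : Set ℝ := Icc (1 / q) (1 / (q * (q - 1)))

/-- The interval `J_q = [(q+q²)/(q⁴-1), (1+q³)/(q⁴-1)]`. -/
def Jq (q : ℝ) : Set ℝ := Icc ((q + q ^ 2) / (q ^ 4 - 1)) ((1 + q ^ 3) / (q ^ 4 - 1))

/-- Apply the first `n` maps of a sequence of maps to `x`:
`applySeq a n x = (a_{n-1} ∘ ⋯ ∘ a_0)(x)`. -/
def applySeq (a : ℕ → ℝ → ℝ) (n : ℕ) (x : ℝ) : ℝ := (List.range n).foldl (fun y k => a k y) x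

/-- `Ω_q(x)`: the set of sequences of maps, each equal to `T_{q,0}` or `T_{q,1}`,
all of whose partial compositions applied to `x` stay in `I_q`. -/
def OmegaSet (q x : ℝ) : Set (ℕ → ℝ → ℝ) :=
  {a | (∀ n, a n = Tmap q 0 ∨ a n = Tmap q 1) ∧ ∀ n : ℕ, applySeq a (n + 1) x ∈ Iq q}

/-- Apply a finite word of digits to `x` (first letter applied first):
for `a = [a₁, …, aₙ]`, `wordMap q a x = (T_{q,aₙ} ∘ ⋯ ∘ T_{q,a₁})(x)`. -/
def wordMap (q : ℝ) (a : List (Fin 2)) (x : ℝ) : ℝ := a.foldl (fun y i => Tmap q i y) x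

/-- A branching sequence for `x`: a finite word whose partial compositions applied to `x`
stay in `I_q`, and whose full composition maps `x` into the switch region `S_q`. -/
def IsBranching (q x : ℝ) (a : List (Fin 2)) : Prop :=
  (∀ k, k ≤ a.length → wordMap q (a.take k) x ∈ Iq q) ∧ wordMap q a x ∈ Sq q

/-- `x` is a `q` null infinite point: `x ∈ (0,1/(q-1))`, `Ω_q(x)` is infinite, and for every
branching sequence `a` for `x` there is a digit `i` with `Ω_q(T_{q,i}(a(x)))` finite. -/
def NullInfinite (q x : ℝ) : Prop :=
  x ∈ Ioo 0 (1 / (q - 1)) ∧ (OmegaSet q x).Infinite ∧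
    ∀ a : List (Fin 2), IsBranching q x a →
      ∃ i : Fin 2, (OmegaSet q (Tmap q i (wordMap q a x))).Finite

/-- `U_q`: points of `I_q` with exactly one `q`-expansion. -/
def UniqSet (q : ℝ) : Set ℝ := {x | x ∈ Iq q ∧ ∃! ε : ℕ → Fin 2, ε ∈ SigmaSet q x}

/-- `B_{ℵ₀}`: bases `q ∈ (1,2)` for which some `x ∈ (0,1/(q-1))` has exactly countably
infinitely many `q`-expansions. -/
def BAleph0 : Set ℝ :=
  {q | q ∈ Ioo (1 : ℝ) 2 ∧ ∃ x ∈ Ioo (0 : ℝ) (1 / (q - 1)),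
    Cardinal.mk ↥(SigmaSet q x) = Cardinal.aleph0}

/-- The eventually periodic binary sequence `u w^∞`: the finite word `u` followed by
infinitely many repetitions of the finite word `w`. -/
def uwInf (u w : List (Fin 2)) : ℕ → Fin 2 := fun i =>
  if i < u.length then u.getD i 0 else w.getD ((i - u.length) % w.length) 0

/-- The sequence with its first digit dropped. -/
def tailSeq (ε : ℕ → Fin 2) : ℕ → Fin 2 := fun n => ε (n + 1)

/-- The sequence with a digit put in front. -/
def consSeq (d : Fin 2) (ε : ℕ → Fin 2) : ℕ → Fin 2 := fun n => Nat.casesOn n d ε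

/-- The orbit of `x` under the maps `T_{q,ε 0}, T_{q,ε 1}, …`. -/
def digitOrbit (q : ℝ) : (ℕ → Fin 2) → ℝ → ℕ → ℝ
  | _, x, 0 => x
  | ε, x, n + 1 => digitOrbit q (tailSeq ε) (Tmap q (ε 0) x) n

/-- `x` has exactly one `q`-expansion. -/
def IsUniq (q x : ℝ) : Prop := ∃! ε : ℕ → Fin 2, ε ∈ SigmaSet q x

/-- `x` has at least two `q`-expansions. -/
def IsMulti (q x : ℝ) : Prop := (SigmaSet q x).Nontrivial

theorem digit_cast_nonneg (d : Fin 2) : (0 : ℝ) ≤ ((d : ℕ) : ℝ) := Nat.cast_nonneg _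

theorem digit_cast_le_one (d : Fin 2) : ((d : ℕ) : ℝ) ≤ 1 := by
  exact_mod_cast Nat.lt_succ_iff.mp d.isLt

theorem hasSum_inv_pow_succ {q : ℝ} (hq : 1 < q) :
    HasSum (fun i : ℕ => 1 / q ^ (i + 1)) (1 / (q - 1)) := by
  have h := (hasSum_geometric_of_lt_one (r := q⁻¹) (by positivity)
    (inv_lt_one_of_one_lt₀ hq)).mul_left q⁻¹
  have h1 : q - 1 ≠ 0 := by linarith
  have h0 : q ≠ 0 := by linarith
  have h2 : q⁻¹ * (1 - q⁻¹)⁻¹ = 1 / (q - 1) := by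
    rw [← mul_inv, mul_sub, mul_inv_cancel₀ h0, mul_one, one_div]
  rw [h2] at h
  refine h.congr_fun fun i => ?_
  rw [pow_succ', inv_pow, one_div, mul_inv]

theorem summable_digits {q : ℝ} (hq : 1 < q) (ε : ℕ → Fin 2) :
    Summable (fun i : ℕ => ((ε i : ℕ) : ℝ) / q ^ (i + 1)) := by
  refine (hasSum_inv_pow_succ hq).summable.of_nonneg_of_le (fun i => ?_) (fun i => ?_)
  · have := digit_cast_nonneg (ε i)
    positivity
  · have := digit_cast_le_one (ε i)
    gcongr

theorem seqVal_nonneg {q : ℝ} (hq : 1 < q) (ε : ℕ → Fin 2) : 0 ≤ seqVal q ε :=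
  tsum_nonneg fun i => div_nonneg (digit_cast_nonneg _) (by positivity)

theorem seqVal_le {q : ℝ} (hq : 1 < q) (ε : ℕ → Fin 2) : seqVal q ε ≤ 1 / (q - 1) := by
  rw [← (hasSum_inv_pow_succ hq).tsum_eq]
  refine (summable_digits hq ε).tsum_le_tsum (fun i => ?_) (hasSum_inv_pow_succ hq).summable
  have := digit_cast_le_one (ε i)
  gcongr

theorem seqVal_eq_cons {q : ℝ} (hq : 1 < q) (ε : ℕ → Fin 2) :
    q * seqVal q ε = ((ε 0 : ℕ) : ℝ) + seqVal q (tailSeq ε) := by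
  have h0 : q ≠ 0 := by linarith
  unfold seqVal
  rw [(summable_digits hq ε).tsum_eq_zero_add, mul_add, ← tsum_mul_left]
  congr 1
  · rw [zero_add, pow_one, mul_div_cancel₀ _ h0]
  · refine tsum_congr fun i => ?_
    simp only [tailSeq]
    rw [pow_succ q (i + 1)]
    field_simp

theorem mem_sigmaSet_iff_tail {q : ℝ} (hq : 1 < q) (x : ℝ) (ε : ℕ → Fin 2) :
    ε ∈ SigmaSet q x ↔ tailSeq ε ∈ SigmaSet q (Tmap q (ε 0) x) := by
  have h := seqVal_eq_cons hq ε
  simp only [SigmaSet, mem_ofPred_eq, Tmap]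
  constructor
  · intro hx
    rw [hx]
    linarith
  · intro hx
    have : q * x = q * seqVal q ε := by linarith
    exact mul_left_cancel₀ (by linarith) this

theorem tailSeq_consSeq (d : Fin 2) (ε : ℕ → Fin 2) : tailSeq (consSeq d ε) = ε := rfl

theorem consSeq_mem_sigmaSet_iff {q : ℝ} (hq : 1 < q) (x : ℝ) (d : Fin 2) (ε : ℕ → Fin 2) :
    consSeq d ε ∈ SigmaSet q x ↔ ε ∈ SigmaSet q (Tmap q d x) :=
  mem_sigmaSet_iff_tail hq x _

theorem consSeq_tailSeq (ε : ℕ → Fin 2) : consSeq (ε 0) (tailSeq ε) = ε := by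
  ext n
  cases n <;> rfl

theorem mem_Iq_of_mem_sigmaSet {q x : ℝ} (hq : 1 < q) {ε : ℕ → Fin 2}
    (h : ε ∈ SigmaSet q x) : x ∈ Iq q := by
  rw [show x = seqVal q ε from h]
  exact ⟨seqVal_nonneg hq ε, seqVal_le hq ε⟩

theorem abs_sub_seqVal_le {q : ℝ} (hq : 1 < q) (n : ℕ) : ∀ (ε : ℕ → Fin 2) (x : ℝ),
    digitOrbit q ε x n ∈ Iq q → |x - seqVal q ε| ≤ 1 / (q - 1) / q ^ n := by
  induction n with
  | zero =>
    intro ε x h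
    have h1 := seqVal_nonneg hq ε
    have h2 := seqVal_le hq ε
    have h3 : x ∈ Iq q := h
    rw [abs_le, pow_zero, div_one]
    constructor <;> linarith [h3.1, h3.2]
  | succ n ih =>
    intro ε x h
    have h1 := ih (tailSeq ε) (Tmap q (ε 0) x) h
    have h2 : Tmap q (ε 0) x - seqVal q (tailSeq ε) = q * (x - seqVal q ε) := by
      rw [mul_sub, seqVal_eq_cons hq ε, Tmap]
      ring
    rw [h2, abs_mul, abs_of_pos (by linarith : (0 : ℝ) < q)] at h1
    rw [pow_succ, ← div_div, le_div_iff₀ (by linarith)]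
    linarith

theorem mem_sigmaSet_of_frequently {q x : ℝ} (hq : 1 < q) {ε : ℕ → Fin 2}
    (h : ∀ k, ∃ n ≥ k, digitOrbit q ε x n ∈ Iq q) : ε ∈ SigmaSet q x := by
  have key : |x - seqVal q ε| ≤ 0 := by
    refine ge_of_tendsto' (f := fun k : ℕ => 1 / (q - 1) / q ^ k) (x := Filter.atTop)
      ?_ fun k => ?_
    · exact (tendsto_pow_atTop_atTop_of_one_lt hq).const_div_atTop _
    · obtain ⟨n, hn, hx⟩ := h k
      refine (abs_sub_seqVal_le hq n ε x hx).trans ?_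
      have : 0 < q - 1 := by linarith
      gcongr
      exact hq.le
  exact sub_eq_zero.mp (abs_nonpos_iff.mp key)

theorem digitOrbit_congr {q : ℝ} (n : ℕ) : ∀ (ε ε' : ℕ → Fin 2) (x : ℝ),
    (∀ i < n, ε i = ε' i) → digitOrbit q ε x n = digitOrbit q ε' x n := by
  induction n with
  | zero => intro _ _ _ _; rfl
  | succ n ih =>
    intro ε ε' x h
    simp only [digitOrbit]
    rw [h 0 n.succ_pos]
    exact ih _ _ _ fun i hi => h (i + 1) (by omega)

/-- The first `n` digits of `ε` followed by `η`. -/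
def spliceSeq (n : ℕ) (ε η : ℕ → Fin 2) : ℕ → Fin 2 := fun i => if i < n then ε i else η (i - n)

theorem digitOrbit_splice {q : ℝ} (m : ℕ) (η : ℕ → Fin 2) (n : ℕ) : ∀ (ε : ℕ → Fin 2) (x : ℝ),
    digitOrbit q (spliceSeq n ε η) x (n + m) = digitOrbit q η (digitOrbit q ε x n) m := by
  induction n with
  | zero =>
    intro ε x
    rw [zero_add]
    exact digitOrbit_congr m _ _ _ fun i _ => by simp [spliceSeq]
  | succ n ih =>
    intro ε x
    rw [show n + 1 + m = (n + m) + 1 by omega]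
    simp only [digitOrbit]
    rw [← ih (tailSeq ε)]
    have h0 : spliceSeq (n + 1) ε η 0 = ε 0 := by simp [spliceSeq]
    rw [h0]
    congr 1
    ext i
    simp [tailSeq, spliceSeq]

theorem exists_digit_mem_Iq {q x : ℝ} (hq : 1 < q) (hq2 : q < 2) (hx : x ∈ Iq q) :
    ∃ d : Fin 2, Tmap q d x ∈ Iq q := by
  have h1 : 0 < q - 1 := by linarith
  obtain ⟨h2, h3⟩ := hx
  have h4 : (q - 1) * (1 / (q - 1)) = 1 := mul_one_div_cancel h1.ne'
  have h5 : 1 ≤ 1 / (q - 1) := by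
    rw [le_div_iff₀ h1]
    linarith
  by_cases h : q * x ≤ 1 / (q - 1)
  · refine ⟨0, ?_, ?_⟩ <;> simp [Tmap]
    · positivity
    · simpa using h
  · refine ⟨1, ?_, ?_⟩ <;> simp only [Tmap, Fin.val_one, Nat.cast_one]
    · linarith
    · nlinarith

theorem exists_mem_sigmaSet {q x : ℝ} (hq : 1 < q) (hq2 : q < 2) (hx : x ∈ Iq q) :
    ∃ ε, ε ∈ SigmaSet q x := by
  choose! d hd using fun (x : ℝ) (hx : x ∈ Iq q) => exists_digit_mem_Iq hq hq2 hx
  let T : ℝ → ℝ := fun y => Tmap q (d y) y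
  have hT : ∀ n, ∀ y ∈ Iq q, digitOrbit q (fun i => d (T^[i] y)) y n ∈ Iq q := by
    intro n
    induction n with
    | zero => intro y hy; exact hy
    | succ n ih =>
      intro y hy
      exact ih (T y) (hd y hy)
  exact ⟨_, mem_sigmaSet_of_frequently hq fun k => ⟨k, le_rfl, hT k x hx⟩⟩

theorem IsMulti.mem_Iq {q x : ℝ} (hq : 1 < q) (h : IsMulti q x) : x ∈ Iq q :=
  mem_Iq_of_mem_sigmaSet hq h.nonempty.some_mem

theorem isUniq_or_isMulti {q x : ℝ} (hq : 1 < q) (hq2 : q < 2) (hx : x ∈ Iq q) :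
    IsUniq q x ∨ IsMulti q x := by
  obtain ⟨ε, hε⟩ := exists_mem_sigmaSet hq hq2 hx
  by_cases h : ∀ ε' ∈ SigmaSet q x, ε' = ε
  · exact Or.inl ⟨ε, hε, h⟩
  · push Not at h
    obtain ⟨ε', h1, h2⟩ := h
    exact Or.inr ⟨ε', h1, ε, hε, h2⟩

theorem IsUniq.not_isMulti {q x : ℝ} (h : IsUniq q x) : ¬ IsMulti q x := by
  rintro ⟨ε, h1, ε', h2, h3⟩
  exact h3 (h.unique h1 h2)

theorem Tmap_mem_Iq_of_mem_Sq {q x : ℝ} (hq : 1 < q) (hx : x ∈ Sq q) (d : Fin 2) :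
    Tmap q d x ∈ Iq q := by
  have h0 : 0 < q := by linarith
  have h1 : 0 < q - 1 := by linarith
  obtain ⟨h2, h3⟩ := hx
  rw [div_le_iff₀ h0] at h2
  rw [← div_div, div_right_comm, le_div_iff₀ h0] at h3
  have := digit_cast_nonneg d
  have := digit_cast_le_one d
  constructor <;> simp only [Tmap] <;> linarith

theorem mem_Sq_of_Tmap_mem_Iq {q x : ℝ} (hq : 1 < q) (h0 : Tmap q 0 x ∈ Iq q)
    (h1 : Tmap q 1 x ∈ Iq q) : x ∈ Sq q := by
  have hq0 : 0 < q := by linarith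
  have h2 := h0.2
  have h3 := h1.1
  simp only [Tmap, Fin.val_zero, Fin.val_one, Nat.cast_zero, Nat.cast_one] at h2 h3
  constructor
  · rw [div_le_iff₀ hq0]
    linarith
  · rw [← div_div, div_right_comm, le_div_iff₀ hq0]
    linarith

theorem isMulti_of_mem_Sq {q x : ℝ} (hq : 1 < q) (hq2 : q < 2) (hx : x ∈ Sq q) :
    IsMulti q x := by
  obtain ⟨ε, h1⟩ := exists_mem_sigmaSet hq hq2 (Tmap_mem_Iq_of_mem_Sq hq hx 0)
  obtain ⟨ε', h2⟩ := exists_mem_sigmaSet hq hq2 (Tmap_mem_Iq_of_mem_Sq hq hx 1)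
  refine ⟨_, (consSeq_mem_sigmaSet_iff hq x 0 ε).mpr h1, _,
    (consSeq_mem_sigmaSet_iff hq x 1 ε').mpr h2, fun h => ?_⟩
  have := congrFun h 0
  simp [consSeq] at this

theorem IsUniq.not_mem_Sq {q x : ℝ} (hq : 1 < q) (hq2 : q < 2) (h : IsUniq q x) : x ∉ Sq q :=
  fun hx => h.not_isMulti (isMulti_of_mem_Sq hq hq2 hx)

theorem IsUniq.exists_Tmap {q x : ℝ} (hq : 1 < q) (h : IsUniq q x) :
    ∃ d, IsUniq q (Tmap q d x) := by
  obtain ⟨ε, h1, h2⟩ := h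
  refine ⟨ε 0, tailSeq ε, (mem_sigmaSet_iff_tail hq x ε).mp h1, fun ε' h3 => ?_⟩
  have := h2 _ ((consSeq_mem_sigmaSet_iff hq x (ε 0) ε').mpr h3)
  exact congrArg tailSeq this

theorem IsUniq.mem_Iq {q x : ℝ} (hq : 1 < q) (h : IsUniq q x) : x ∈ Iq q :=
  mem_Iq_of_mem_sigmaSet hq h.choose_spec.1

/-- The digitwise reflection. -/
def flipSeq (ε : ℕ → Fin 2) : ℕ → Fin 2 := fun i => 1 - ε i

theorem flip_digit_cast (d : Fin 2) : (((1 - d : Fin 2) : ℕ) : ℝ) = 1 - ((d : ℕ) : ℝ) := by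
  fin_cases d <;> simp

theorem flipSeq_flipSeq (ε : ℕ → Fin 2) : flipSeq (flipSeq ε) = ε := by
  ext i
  simp [flipSeq]

theorem flipSeq_mem_sigmaSet {q x : ℝ} (hq : 1 < q) {ε : ℕ → Fin 2} (h : ε ∈ SigmaSet q x) :
    flipSeq ε ∈ SigmaSet q (1 / (q - 1) - x) := by
  have h1 := (hasSum_inv_pow_succ hq).sub (summable_digits hq ε).hasSum
  have h2 : x = seqVal q ε := h
  rw [SigmaSet, mem_ofPred_eq, h2]
  refine Eq.trans ?_ (h1.tsum_eq.symm.trans (tsum_congr fun i => ?_))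
  · rfl
  · rw [flipSeq, flip_digit_cast]
    ring

theorem IsMulti.reflect {q x : ℝ} (hq : 1 < q) (h : IsMulti q x) :
    IsMulti q (1 / (q - 1) - x) := by
  obtain ⟨ε, h1, ε', h2, h3⟩ := h
  exact ⟨_, flipSeq_mem_sigmaSet hq h1, _, flipSeq_mem_sigmaSet hq h2,
    (Function.LeftInverse.injective flipSeq_flipSeq).ne h3⟩

theorem Tmap_reflect {q : ℝ} (hq : 1 < q) (d : Fin 2) (x : ℝ) :
    Tmap q (1 - d) (1 / (q - 1) - x) = 1 / (q - 1) - Tmap q d x := by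
  have h1 : q - 1 ≠ 0 := by linarith
  rw [Tmap, Tmap, flip_digit_cast]
  field_simp
  ring

theorem IsUniq.reflect {q x : ℝ} (hq : 1 < q) (h : IsUniq q x) :
    IsUniq q (1 / (q - 1) - x) := by
  obtain ⟨ε, h1, h2⟩ := h
  refine ⟨_, flipSeq_mem_sigmaSet hq h1, fun ε' h3 => ?_⟩
  have := flipSeq_mem_sigmaSet hq h3
  rw [sub_sub_cancel] at this
  rw [← h2 _ this, flipSeq_flipSeq]

/-- `y` is reached from `x` by finitely many maps. -/
def Reaches (q : ℝ) : ℝ → ℝ → Prop := Relation.ReflTransGen fun x y => ∃ d, y = Tmap q d x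

/-- Both images of `x` have at least two expansions. -/
def SplitsMulti (q x : ℝ) : Prop := ∀ d, IsMulti q (Tmap q d x)

/-- `x` has several expansions, but no point reached from it splits into two such points. -/
def NeverSplits (q x : ℝ) : Prop := IsMulti q x ∧ ∀ y, Reaches q x y → ¬ SplitsMulti q y

theorem Reaches.exists_avoiding {q z y : ℝ} (h : Reaches q z y) (hy : SplitsMulti q y) :
    ∀ g : ℕ → Fin 2, ∃ m η, IsMulti q (digitOrbit q η z m) ∧ ∃ i < m, η i ≠ g i := by
  induction h using Relation.ReflTransGen.head_induction_on with
  | refl =>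
    intro g
    refine ⟨1, fun _ => 1 - g 0, hy _, 0, one_pos, ?_⟩
    generalize g 0 = d
    fin_cases d <;> simp
  | head hstep _ ih =>
    intro g
    obtain ⟨d, rfl⟩ := hstep
    obtain ⟨m, η, h1, i, h2, h3⟩ := ih (tailSeq g)
    exact ⟨m + 1, consSeq d η, h1, i + 1, by omega, h3⟩

theorem not_countable_of_forall_not_neverSplits {q : ℝ} (hq : 1 < q)
    (H : ∀ y, ¬ NeverSplits q y) {x : ℝ} (hx : IsMulti q x) : ¬ (SigmaSet q x).Countable := by
  intro hc
  obtain ⟨f, hf⟩ := hc.exists_eq_range hx.nonempty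
  have step : ∀ (s : {p : ℕ × (ℕ → Fin 2) // IsMulti q (digitOrbit q p.2 x p.1)}) (k : ℕ),
      ∃ s' : {p : ℕ × (ℕ → Fin 2) // IsMulti q (digitOrbit q p.2 x p.1)},
        s.1.1 < s'.1.1 ∧ (∀ i < s.1.1, s'.1.2 i = s.1.2 i) ∧
          ∃ i < s'.1.1, s'.1.2 i ≠ f k i := by
    rintro ⟨⟨n, ε⟩, hs⟩ k
    have h1 : ∃ y, Reaches q (digitOrbit q ε x n) y ∧ SplitsMulti q y := by
      by_contra! h
      exact H _ ⟨hs, h⟩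
    obtain ⟨y, h2, h3⟩ := h1
    obtain ⟨m, η, h4, i, h5, h6⟩ := h2.exists_avoiding h3 fun j => f k (n + j)
    refine ⟨⟨(n + m, spliceSeq n ε η), ?_⟩, ?_, ?_, n + i, ?_, ?_⟩
    · simpa only [digitOrbit_splice] using h4
    · simp only
      omega
    · intro j hj
      simp only at hj
      simp [spliceSeq, hj]
    · simp only
      omega
    · simpa [spliceSeq] using h6
  choose F hF1 hF2 hF3 using step
  let s : ℕ → {p : ℕ × (ℕ → Fin 2) // IsMulti q (digitOrbit q p.2 x p.1)} :=
    fun k => Nat.rec ⟨(0, fun _ => 0), hx⟩ (fun k t => F t k) k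
  have hs : ∀ k, s (k + 1) = F (s k) k := fun _ => rfl
  have hlen : ∀ k, k ≤ (s k).1.1 := by
    intro k
    induction k with
    | zero => exact Nat.zero_le _
    | succ k ih =>
      have := hF1 (s k) k
      rw [← hs] at this
      omega
  have hmono : ∀ j m, (s j).1.1 ≤ (s (j + m)).1.1 ∧
      ∀ i < (s j).1.1, (s (j + m)).1.2 i = (s j).1.2 i := by
    intro j m
    induction m with
    | zero => simp
    | succ m ih =>
      have h1 := hF1 (s (j + m)) (j + m)
      have h2 := hF2 (s (j + m)) (j + m)
      rw [← hs] at h1 h2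
      refine ⟨by rw [← add_assoc]; omega, fun i hi => ?_⟩
      rw [← add_assoc, h2 i (by omega), ih.2 i hi]
  let ε : ℕ → Fin 2 := fun i => (s (i + 1)).1.2 i
  have hε : ∀ k, ∀ i < (s k).1.1, ε i = (s k).1.2 i := by
    intro k i hi
    have h1 := (hmono k (i + 1)).2 i hi
    have h2 := (hmono (i + 1) k).2 i (by have := hlen (i + 1); omega)
    rw [add_comm] at h2
    exact h2.symm.trans h1
  have hmem : ε ∈ SigmaSet q x := by
    refine mem_sigmaSet_of_frequently hq fun k => ⟨(s k).1.1, hlen k, ?_⟩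
    rw [digitOrbit_congr _ _ _ _ (hε k)]
    exact (s k).2.mem_Iq hq
  rw [hf] at hmem
  obtain ⟨k, hk⟩ := hmem
  obtain ⟨i, hi, hne⟩ := hF3 (s k) k
  rw [← hs] at hi hne
  exact hne (by rw [← hε (k + 1) i hi, hk])

theorem NeverSplits.Tmap {q x : ℝ} (h : NeverSplits q x) {d : Fin 2}
    (hd : IsMulti q (Tmap q d x)) : NeverSplits q (Tmap q d x) :=
  ⟨hd, fun y hy => h.2 y (Relation.ReflTransGen.head ⟨d, rfl⟩ hy)⟩

theorem NeverSplits.reflect {q x : ℝ} (hq : 1 < q) (h : NeverSplits q x) :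
    NeverSplits q (1 / (q - 1) - x) := by
  refine ⟨h.1.reflect hq, fun y hy hs => ?_⟩
  have h1 : Reaches q (1 / (q - 1) - (1 / (q - 1) - x)) (1 / (q - 1) - y) := by
    refine Relation.ReflTransGen.lift (fun z => 1 / (q - 1) - z) ?_ _ _ hy
    rintro a b ⟨d, rfl⟩
    exact ⟨1 - d, (Tmap_reflect hq d a).symm⟩
  rw [sub_sub_cancel] at h1
  refine h.2 _ h1 fun d => ?_
  have h2 := Tmap_reflect hq (1 - d) y
  rw [sub_sub_cancel] at h2
  rw [h2]
  exact (hs _).reflect hq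

theorem NeverSplits.exists_mem_Sq {q x : ℝ} (hq : 1 < q) (h : NeverSplits q x) :
    ∃ y ∈ Sq q, NeverSplits q y := by
  obtain ⟨ε, h1, ε', h2, hne⟩ := h.1
  obtain ⟨n, hn⟩ := Function.ne_iff.mp hne
  clear hne
  induction n generalizing x ε ε' with
  | zero =>
    refine ⟨x, ?_, h⟩
    have h3 := mem_Iq_of_mem_sigmaSet hq ((mem_sigmaSet_iff_tail hq x ε).mp h1)
    have h4 := mem_Iq_of_mem_sigmaSet hq ((mem_sigmaSet_iff_tail hq x ε').mp h2)
    generalize ε 0 = d at *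
    generalize ε' 0 = d' at *
    fin_cases d <;> fin_cases d' <;> simp at hn h3 h4
    · exact mem_Sq_of_Tmap_mem_Iq hq h3 h4
    · exact mem_Sq_of_Tmap_mem_Iq hq h4 h3
  | succ n ih =>
    have h3 := (mem_sigmaSet_iff_tail hq x ε).mp h1
    have h4 := (mem_sigmaSet_iff_tail hq x ε').mp h2
    by_cases h0 : ε 0 = ε' 0
    · rw [← h0] at h4
      exact ih (h.Tmap ⟨_, h3, _, h4, fun he => hn (congrFun he n)⟩) _ h3 _ h4 hn
    · refine ⟨x, ?_, h⟩
      replace h3 := mem_Iq_of_mem_sigmaSet hq h3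
      replace h4 := mem_Iq_of_mem_sigmaSet hq h4
      generalize ε 0 = d at *
      generalize ε' 0 = d' at *
      fin_cases d <;> fin_cases d' <;> simp at h0 h3 h4
      · exact mem_Sq_of_Tmap_mem_Iq hq h3 h4
      · exact mem_Sq_of_Tmap_mem_Iq hq h4 h3

theorem Tmap_zero (q x : ℝ) : Tmap q 0 x = q * x := by simp [Tmap]

theorem Tmap_one (q x : ℝ) : Tmap q 1 x = q * x - 1 := by simp [Tmap]

theorem IsUniq.mul_of_lt {q x : ℝ} (hq : 1 < q) (h : IsUniq q x) (hx : x < 1 / q) :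
    IsUniq q (q * x) := by
  obtain ⟨d, hd⟩ := h.exists_Tmap hq
  rw [lt_div_iff₀ (by linarith)] at hx
  fin_cases d
  · simpa [Tmap_zero] using hd
  · have := (hd.mem_Iq hq).1
    simp [Tmap_one] at this
    linarith

theorem mul_gt_of_gt {q x : ℝ} (hq : 1 < q) (hx : 1 / (q * (q - 1)) < x) :
    1 / (q - 1) < q * x := by
  rw [← div_div, div_right_comm, div_lt_iff₀ (by linarith)] at hx
  linarith

theorem IsUniq.mul_sub_one_of_gt {q x : ℝ} (hq : 1 < q) (h : IsUniq q x)
    (hx : 1 / (q * (q - 1)) < x) : IsUniq q (q * x - 1) := by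
  obtain ⟨d, hd⟩ := h.exists_Tmap hq
  have hx := mul_gt_of_gt hq hx
  fin_cases d
  · have := (hd.mem_Iq hq).2
    simp only [Fin.zero_eta, Tmap_zero] at this
    linarith
  · simpa [Tmap_one] using hd

theorem NeverSplits.mul_sub_one_of_gt {q x : ℝ} (hq : 1 < q) (h : NeverSplits q x)
    (hx : 1 / (q * (q - 1)) < x) : NeverSplits q (q * x - 1) := by
  have hx := mul_gt_of_gt hq hx
  have key : ∀ ε ∈ SigmaSet q x, ε 0 = 1 := by
    intro ε hε
    have := (mem_Iq_of_mem_sigmaSet hq ((mem_sigmaSet_iff_tail hq x ε).mp hε)).2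
    generalize ε 0 = d at *
    fin_cases d
    · simp only [Fin.zero_eta, Tmap_zero] at this
      linarith
    · rfl
  obtain ⟨ε, h1, ε', h2, h3⟩ := h.1
  rw [← Tmap_one]
  refine h.Tmap ⟨tailSeq ε, ?_, tailSeq ε', ?_, fun he => h3 ?_⟩
  · rw [← key ε h1]
    exact (mem_sigmaSet_iff_tail hq x ε).mp h1
  · rw [← key ε' h2]
    exact (mem_sigmaSet_iff_tail hq x ε').mp h2
  · rw [← consSeq_tailSeq ε, ← consSeq_tailSeq ε', he, key ε h1, key ε' h2]

/-- The bases strictly between the golden ratio and `q_{ℵ₀}`, described by polynomial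
inequalities. -/
structure IsSmallBase (q : ℝ) : Prop where
  one_lt : 1 < q
  golden : q + 1 < q ^ 2
  sextic : q ^ 6 < q ^ 4 + q ^ 3 + 2 * q ^ 2 + q + 1

theorem sextic_lt_of_lt {q r : ℝ} (hq : 0 < q) (hqr : q < r)
    (hr : r ^ 6 ≤ r ^ 4 + r ^ 3 + 2 * r ^ 2 + r + 1) :
    q ^ 6 < q ^ 4 + q ^ 3 + 2 * q ^ 2 + q + 1 := by
  have hr0 : 0 < r := hq.trans hqr
  have e : ∀ s : ℝ, 0 < s → (s ^ 4 + s ^ 3 + 2 * s ^ 2 + s + 1) / s ^ 6 =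
      (1 / s) ^ 2 + (1 / s) ^ 3 + 2 * (1 / s) ^ 4 + (1 / s) ^ 5 + (1 / s) ^ 6 := by
    intro s hs
    field_simp
  have h1 : 1 ≤ (r ^ 4 + r ^ 3 + 2 * r ^ 2 + r + 1) / r ^ 6 := by
    rwa [le_div_iff₀ (by positivity), one_mul]
  have h2 : 1 < (q ^ 4 + q ^ 3 + 2 * q ^ 2 + q + 1) / q ^ 6 := by
    refine h1.trans_lt ?_
    rw [e r hr0, e q hq]
    have : 1 / r < 1 / q := one_div_lt_one_div_of_lt hq hqr
    have : 0 < 1 / r := by positivity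
    gcongr
  rwa [lt_div_iff₀ (by positivity), one_mul] at h2

/-- The value of `0^k (10)^∞` in base `q`. -/
def altVal (q : ℝ) (k : ℕ) : ℝ := q / ((q ^ 2 - 1) * q ^ k)

namespace IsSmallBase

variable {q : ℝ}

theorem pos (h : IsSmallBase q) : 0 < q := by linarith [h.one_lt]

theorem sq_sub_one_pos (h : IsSmallBase q) : 0 < q ^ 2 - 1 := by linarith [h.golden, h.pos]

theorem lt_bound (h : IsSmallBase q) : q < 1.65 := by
  by_contra! hc
  rcases hc.eq_or_lt with rfl | hc
  · have := h.sextic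
    norm_num at this
  · have := sextic_lt_of_lt (by norm_num) hc h.sextic.le
    norm_num at this

theorem lt_two (h : IsSmallBase q) : q < 2 := by linarith [h.lt_bound]

theorem gt_bound (h : IsSmallBase q) : 1.618 < q := by
  nlinarith [h.golden, h.one_lt]

theorem altVal_pos (h : IsSmallBase q) (k : ℕ) : 0 < altVal q k := by
  have := h.sq_sub_one_pos
  have := h.pos
  unfold altVal
  positivity

theorem mul_altVal (h : IsSmallBase q) (k : ℕ) : q * altVal q (k + 1) = altVal q k := by
  have := h.sq_sub_one_pos
  have := h.pos
  unfold altVal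
  field_simp
  exact (pow_succ' q k).symm

theorem altVal_strictAnti (h : IsSmallBase q) : StrictAnti (altVal q) := by
  refine strictAnti_nat_of_succ_lt fun k => ?_
  have := h.altVal_pos (k + 1)
  rw [← h.mul_altVal k]
  nlinarith [h.one_lt]

theorem altVal_zero_eq (h : IsSmallBase q) :
    altVal q 0 = 1 - (q ^ 2 - q - 1) / (q ^ 2 - 1) := by
  have := h.sq_sub_one_pos
  unfold altVal
  field_simp
  ring

theorem altVal_one_eq (h : IsSmallBase q) : q * altVal q 0 = 1 + altVal q 1 := by
  have := h.sq_sub_one_pos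
  have := h.pos
  unfold altVal
  field_simp
  ring

theorem add_lt_gap (h : IsSmallBase q) :
    altVal q 2 + altVal q 4 < 1 / (q - 1) - 1 - (q ^ 2 - q - 1) := by
  have h1 := h.sq_sub_one_pos
  have h2 := h.pos
  have h3 : 0 < q - 1 := by linarith [h.one_lt]
  have h4 := h.sextic
  have e : 1 / (q - 1) - 1 - (q ^ 2 - q - 1) - (altVal q 2 + altVal q 4) =
      (q - 1) * (q ^ 4 + q ^ 3 + 2 * q ^ 2 + q + 1 - q ^ 6) / (q ^ 3 * (q ^ 2 - 1)) := by
    unfold altVal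
    field_simp
    ring
  have : 0 < q ^ 4 + q ^ 3 + 2 * q ^ 2 + q + 1 - q ^ 6 := by linarith
  rw [← sub_pos, e]
  positivity

theorem gap_lt_add (h : IsSmallBase q) :
    1 / (q - 1) - 1 < altVal q 2 + altVal q 3 := by
  have h1 := h.sq_sub_one_pos
  have h2 := h.pos
  have h3 : 0 < q - 1 := by linarith [h.one_lt]
  have h4 : 0 < q ^ 2 - q - 1 := by linarith [h.golden]
  have e : altVal q 2 + altVal q 3 - (1 / (q - 1) - 1) = (q ^ 2 - q - 1) / q ^ 2 := by
    unfold altVal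
    field_simp
    ring
  rw [← sub_pos, e]
  positivity

theorem gap_lt_altVal_one (h : IsSmallBase q) : 1 / (q - 1) - 1 < altVal q 1 := by
  have h1 := h.sq_sub_one_pos
  have h2 := h.pos
  have h3 : 0 < q - 1 := by linarith [h.one_lt]
  have h4 : 0 < q ^ 2 - q - 1 := by linarith [h.golden]
  have e : altVal q 1 - (1 / (q - 1) - 1) = (q ^ 2 - q - 1) / (q ^ 2 - 1) := by
    unfold altVal
    field_simp
    ring
  rw [← sub_pos, e]
  positivity

theorem gap_lt_inv (h : IsSmallBase q) : 1 / (q - 1) - 1 < 1 / q := by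
  have h2 := h.pos
  have h3 : 0 < q - 1 := by linarith [h.one_lt]
  have h4 : 0 < q ^ 2 - q - 1 := by linarith [h.golden]
  have e : 1 / q - (1 / (q - 1) - 1) = (q ^ 2 - q - 1) / (q * (q - 1)) := by
    field_simp
    ring
  rw [← sub_pos, e]
  positivity

theorem switch_lt_one (h : IsSmallBase q) : 1 / (q * (q - 1)) < 1 := by
  have h2 := h.pos
  have h3 : 0 < q - 1 := by linarith [h.one_lt]
  rw [div_lt_one (by positivity)]
  linarith [h.golden]

theorem switch_lt_altVal_zero (h : IsSmallBase q) : 1 / (q * (q - 1)) < altVal q 0 := by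
  have h1 := h.sq_sub_one_pos
  have h2 := h.pos
  have h3 : 0 < q - 1 := by linarith [h.one_lt]
  have h4 : 0 < q ^ 2 - q - 1 := by linarith [h.golden]
  have e : altVal q 0 - 1 / (q * (q - 1)) = (q ^ 2 - q - 1) / (q * (q ^ 2 - 1)) := by
    unfold altVal
    field_simp
    ring
  rw [← sub_pos, e]
  positivity

theorem altVal_one_lt_inv (h : IsSmallBase q) : altVal q 1 < 1 / q := by
  have h1 := h.sq_sub_one_pos
  have h2 := h.pos
  have e : 1 / q - altVal q 1 = (q ^ 2 - q - 1) / (q * (q ^ 2 - 1)) := by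
    unfold altVal
    field_simp
    ring
  have h4 : 0 < q ^ 2 - q - 1 := by linarith [h.golden]
  rw [← sub_pos, e]
  positivity

theorem large_offset_lt (h : IsSmallBase q) :
    q ^ 2 * (q ^ 2 - q - 1) + altVal q 0 - 1 < 1 / (q - 1) - 1 - altVal q 2 := by
  have h1 := h.sq_sub_one_pos
  have h2 := h.pos
  have h3 : 0 < q - 1 := by linarith [h.one_lt]
  have h4 : 0 < q ^ 2 - q - 1 := by linarith [h.golden]
  have h5 := h.lt_bound
  have h6 := h.gt_bound
  have e : 1 / (q - 1) - 1 - altVal q 2 - (q ^ 2 * (q ^ 2 - q - 1) + altVal q 0 - 1) =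
      (q - 1 - q ^ 3 * ((q ^ 2 - 1) * (q ^ 2 - q - 1))) / (q * (q ^ 2 - 1)) := by
    unfold altVal
    field_simp
    ring
  have h7 : q ^ 2 ≤ 1.65 ^ 2 := by gcongr
  have h8 : q ^ 3 * ((q ^ 2 - 1) * (q ^ 2 - q - 1)) ≤
      1.65 ^ 3 * ((1.65 ^ 2 - 1) * (1.65 ^ 2 - 1.65 - 1)) := by
    have : q ^ 2 - q - 1 ≤ 1.65 ^ 2 - 1.65 - 1 := by nlinarith
    gcongr
  have h9 : 0 < q - 1 - q ^ 3 * ((q ^ 2 - 1) * (q ^ 2 - q - 1)) := by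
    norm_num at h8 h6
    linarith
  rw [← sub_pos, e]
  positivity

theorem lt_small_offset (h : IsSmallBase q) :
    q ^ 2 - q - 1 < q * (q ^ 2 - q - 1) + altVal q 0 - 1 := by
  have h1 := h.sq_sub_one_pos
  have h2 := h.pos
  have h4 : 0 < q ^ 2 - q - 1 := by linarith [h.golden]
  have e : q * (q ^ 2 - q - 1) + altVal q 0 - 1 - (q ^ 2 - q - 1) =
      q * (q ^ 2 - q - 1) ^ 2 / (q ^ 2 - 1) := by
    unfold altVal
    field_simp
    ring
  rw [← sub_pos, e]
  positivity

/-- A point with a unique expansion strictly between the switch region and `1` is `(10)^∞`. -/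
theorem eq_altVal_zero (h : IsSmallBase q) {z : ℝ} (hz : IsUniq q z)
    (h1 : 1 / (q * (q - 1)) < z) (h2 : z < 1) : z = altVal q 0 := by
  have hq := h.one_lt
  have hq0 := h.pos
  have hq1 : 0 < q - 1 := by linarith
  have hlo := h.gt_bound
  have hhi := h.lt_bound
  have step : ∀ y : ℝ, IsUniq q y → 1 / (q * (q - 1)) < y → y < 1 →
      IsUniq q (q * (q * y - 1)) ∧ 1 / (q * (q - 1)) < q * (q * y - 1) ∧
        q * (q * y - 1) < 1 := by
    intro y hy h3 h4
    have h5 := hy.mul_sub_one_of_gt hq h3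
    have h6 := mul_gt_of_gt hq h3
    have h7 : q - 1 ≤ 1 / (q * (q - 1)) := by
      have h11 : (q - 1) * (q * (q - 1)) ≤ (1.65 - 1) * (1.65 * (1.65 - 1)) := by gcongr
      rw [le_div_iff₀ (by positivity)]
      norm_num at h11
      linarith
    have h8 : q * y - 1 < 1 / q := by
      by_contra! hc
      exact h5.not_mem_Sq hq h.lt_two ⟨hc, by nlinarith⟩
    have h9 := h5.mul_of_lt hq h8
    have h10 : q * (q * y - 1) < 1 := by
      rw [lt_div_iff₀ hq0] at h8
      linarith
    refine ⟨h9, ?_, h10⟩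
    by_contra! hc
    refine h9.not_mem_Sq hq h.lt_two ⟨?_, hc⟩
    have h11 : 1 / q ≤ q * (1 / (q - 1) - 1) := by
      have h12 : 0 < (q ^ 2 - q - 1) * (2 - q) :=
        mul_pos (by linarith [h.golden]) (by linarith)
      rw [div_le_iff₀ hq0, div_sub_one hq1.ne', mul_div_assoc', div_mul_eq_mul_div,
        le_div_iff₀ hq1]
      nlinarith
    refine h11.trans ?_
    gcongr
  have hfix : q * (q * altVal q 0 - 1) = altVal q 0 := by
    rw [h.altVal_one_eq, add_sub_cancel_left, h.mul_altVal]
  have hbd : ∀ n : ℕ, ∃ y, IsUniq q y ∧ 1 / (q * (q - 1)) < y ∧ y < 1 ∧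
      y - altVal q 0 = (q ^ 2) ^ n * (z - altVal q 0) := by
    intro n
    induction n with
    | zero => exact ⟨z, hz, h1, h2, by simp⟩
    | succ n ih =>
      obtain ⟨y, h3, h4, h5, h6⟩ := ih
      obtain ⟨h7, h8, h9⟩ := step y h3 h4 h5
      refine ⟨_, h7, h8, h9, ?_⟩
      rw [pow_succ, mul_right_comm, ← h6]
      linear_combination hfix
  by_contra hne
  have hpos : 0 < |z - altVal q 0| := abs_pos.mpr (sub_ne_zero.mpr hne)
  obtain ⟨n, hn⟩ := pow_unbounded_of_one_lt (1 / |z - altVal q 0|)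
    (by linarith [h.golden] : 1 < q ^ 2)
  obtain ⟨y, -, h4, h5, h6⟩ := hbd n
  rw [div_lt_iff₀ hpos, ← abs_of_pos (by positivity : 0 < (q ^ 2) ^ n), ← abs_mul, ← h6,
    lt_abs] at hn
  have h7 := h.altVal_pos 0
  have h8 := h.altVal_zero_eq
  have h9 : 0 < (q ^ 2 - q - 1) / (q ^ 2 - 1) :=
    div_pos (by linarith [h.golden]) h.sq_sub_one_pos
  have h10 : 0 < 1 / (q * (q - 1)) := by positivity
  rcases hn with hn | hn <;> linarith

theorem exists_eq_altVal (h : IsSmallBase q) (n : ℕ) : ∀ x : ℝ, IsUniq q x → 0 < x → x < 1 / q →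
    1 / q ≤ q ^ n * x → ∃ k, x = altVal q k := by
  have hq := h.one_lt
  have hq0 := h.pos
  induction n with
  | zero =>
    intro x _ _ h3 h4
    rw [pow_zero, one_mul] at h4
    exact absurd h4 (not_le.mpr h3)
  | succ n ih =>
    intro x h1 h2 h3 h4
    have h5 := h1.mul_of_lt hq h3
    have h6 : ∃ k, q * x = altVal q k := by
      rcases lt_or_ge (q * x) (1 / q) with h7 | h7
      · exact ih _ h5 (by positivity) h7 (by rwa [← mul_assoc, ← pow_succ])
      · refine ⟨0, h.eq_altVal_zero h5 ?_ ?_⟩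
        · by_contra! hc
          exact h5.not_mem_Sq hq h.lt_two ⟨h7, hc⟩
        · rw [lt_div_iff₀ hq0] at h3
          linarith
    obtain ⟨k, hk⟩ := h6
    refine ⟨k + 1, mul_left_cancel₀ hq0.ne' ?_⟩
    rw [hk, h.mul_altVal]

/-- The points of the shape `0^∞` or `0^k (10)^∞` with `k ≥ 2`. -/
def smallUniq (q : ℝ) : Set ℝ := {w | w = 0 ∨ ∃ k ≥ 2, w = altVal q k}

theorem mem_smallUniq (h : IsSmallBase q) {x : ℝ} (hx : IsUniq q x)
    (hx1 : x ≤ 1 / (q - 1) - 1) : x ∈ smallUniq q := by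
  have hq := h.one_lt
  have hq0 := h.pos
  rcases (hx.mem_Iq hq).1.eq_or_lt with h0 | h0
  · exact Or.inl h0.symm
  · have h1 : x < 1 / q := hx1.trans_lt h.gap_lt_inv
    obtain ⟨n, hn⟩ := pow_unbounded_of_one_lt (1 / q / x) hq
    rw [div_lt_iff₀ h0] at hn
    obtain ⟨k, rfl⟩ := h.exists_eq_altVal n x hx h0 h1 hn.le
    refine Or.inr ⟨k, ?_, rfl⟩
    by_contra! hk
    have := h.altVal_strictAnti.antitone (show k ≤ 1 by omega)
    linarith [h.gap_lt_altVal_one]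

theorem smallUniq_le (h : IsSmallBase q) {w : ℝ} (hw : w ∈ smallUniq q) : w ≤ altVal q 2 := by
  rcases hw with rfl | ⟨k, hk, rfl⟩
  · exact (h.altVal_pos 2).le
  · exact h.altVal_strictAnti.antitone hk

theorem two_mul_altVal_three_le (h : IsSmallBase q) :
    2 * altVal q 3 ≤ altVal q 2 + altVal q 4 := by
  have h1 := h.mul_altVal 2
  have h2 := h.mul_altVal 3
  have h3 := h.altVal_pos 4
  have : 0 ≤ (q - 1) ^ 2 * altVal q 4 := by positivity
  rw [← h1, ← h2]
  linarith

theorem add_ne (h : IsSmallBase q) {t w w' : ℝ} (h1 : altVal q 2 + altVal q 4 < t)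
    (h2 : t < altVal q 2 + altVal q 3) (hw : w ∈ smallUniq q) (hw' : w' ∈ smallUniq q) :
    w + w' ≠ t := by
  have h3 := h.two_mul_altVal_three_le
  have key : ∀ u ∈ smallUniq q, u = altVal q 2 ∨ u = altVal q 3 ∨ u ≤ altVal q 4 := by
    rintro u (rfl | ⟨k, hk, rfl⟩)
    · exact Or.inr (Or.inr (h.altVal_pos 4).le)
    · by_cases hk4 : 4 ≤ k
      · exact Or.inr (Or.inr (h.altVal_strictAnti.antitone hk4))
      · obtain rfl | rfl : k = 2 ∨ k = 3 := by omega
        · exact Or.inl rfl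
        · exact Or.inr (Or.inl rfl)
  have h4 := h.smallUniq_le hw
  have h5 := h.smallUniq_le hw'
  have h6 := h.altVal_strictAnti (show 2 < 3 by omega)
  have h7 := h.altVal_strictAnti (show 3 < 4 by omega)
  intro he
  rcases key w hw with hu | hu | hu <;> rcases key w' hw' with hv | hv | hv <;> linarith

/-- The next point of a chain of non-splitting points, in terms of the offset `d` of the point
`(1 + d) / q` of the switch region. -/
theorem neverSplits_next (h : IsSmallBase q) {d : ℝ} (hb : NeverSplits q ((1 + d) / q))
    (hd0 : 0 ≤ d) (hd : 1 / (q - 1) - 1 - d ∉ smallUniq q) (hd1 : d ≤ 1 / (q - 1) - 1) :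
    NeverSplits q ((1 + (q ^ 2 - q - 1 + q ^ 2 * d)) / q) := by
  have hq := h.one_lt
  have hq0 := h.pos
  have e0 : Tmap q 0 ((1 + d) / q) = 1 + d := by
    rw [Tmap_zero]
    field_simp
  have h1 : IsMulti q (1 + d) := by
    rcases isUniq_or_isMulti hq h.lt_two
      (show 1 + d ∈ Iq q from ⟨by linarith, by linarith⟩) with hu | hm
    · refine absurd (h.mem_smallUniq (hu.reflect hq) (by linarith)) ?_
      rwa [← sub_sub]
    · exact hm
  have h2 : NeverSplits q (1 + d) := e0 ▸ hb.Tmap (by rwa [e0])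
  have h3 := h2.mul_sub_one_of_gt hq (by linarith [h.switch_lt_one])
  convert h3 using 1
  field_simp
  ring

theorem neverSplits_cases (h : IsSmallBase q) {d : ℝ} (hb : NeverSplits q ((1 + d) / q))
    (hd0 : 0 ≤ d) (hd1 : d ≤ 1 / (q - 1) - 1) :
    d ∈ smallUniq q ∨ 1 / (q - 1) - 1 - d ∈ smallUniq q := by
  have hq := h.one_lt
  have hq0 := h.pos
  have e0 : Tmap q 0 ((1 + d) / q) = 1 + d := by
    rw [Tmap_zero]
    field_simp
  have e1 : Tmap q 1 ((1 + d) / q) = d := by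
    rw [Tmap_one]
    field_simp
    ring
  by_contra! hc
  refine hb.2 _ Relation.ReflTransGen.refl fun i => ?_
  have hm : IsMulti q d := by
    rcases isUniq_or_isMulti hq h.lt_two
      (show d ∈ Iq q from ⟨by linarith, by linarith⟩) with hu | hm
    · exact absurd (h.mem_smallUniq hu hd1) hc.1
    · exact hm
  have hm' : IsMulti q (1 + d) := by
    rcases isUniq_or_isMulti hq h.lt_two
      (show 1 + d ∈ Iq q from ⟨by linarith, by linarith⟩) with hu | hm
    · refine absurd (h.mem_smallUniq (hu.reflect hq) (by linarith)) ?_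
      rw [← sub_sub]
      exact hc.2
    · exact hm
  fin_cases i
  · rwa [Fin.zero_eta, e0]
  · rwa [Fin.mk_one, e1]

theorem gap_sub_not_mem (h : IsSmallBase q) {d : ℝ} (hd : d ∈ smallUniq q) :
    1 / (q - 1) - 1 - d ∉ smallUniq q := fun hc =>
  h.add_ne (by linarith [h.add_lt_gap, h.golden]) h.gap_lt_add hd hc (add_sub_cancel _ _)

theorem smallUniq_nonneg (h : IsSmallBase q) {w : ℝ} (hw : w ∈ smallUniq q) : 0 ≤ w := by
  rcases hw with rfl | ⟨k, _, rfl⟩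
  · exact le_rfl
  · exact (h.altVal_pos k).le

theorem altVal_two_lt_gap (h : IsSmallBase q) : altVal q 2 < 1 / (q - 1) - 1 := by
  linarith [h.add_lt_gap, h.golden, h.altVal_pos 4]

theorem neverSplits_next_of_mem (h : IsSmallBase q) {d : ℝ}
    (hb : NeverSplits q ((1 + d) / q)) (hd : d ∈ smallUniq q) :
    NeverSplits q ((1 + (q ^ 2 - q - 1 + q ^ 2 * d)) / q) :=
  h.neverSplits_next hb (h.smallUniq_nonneg hd) (h.gap_sub_not_mem hd)
    ((h.smallUniq_le hd).trans h.altVal_two_lt_gap.le)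

theorem sq_mul_altVal (h : IsSmallBase q) (k : ℕ) : q ^ 2 * altVal q (k + 2) = altVal q k := by
  rw [pow_two, mul_assoc, h.mul_altVal (k + 1), h.mul_altVal]

theorem exists_next_index (h : IsSmallBase q) {k : ℕ}
    (hb : NeverSplits q ((1 + altVal q (k + 4)) / q)) :
    ∃ j ≥ 2, q ^ 2 - q - 1 + altVal q (k + 2) = altVal q j ∧
      NeverSplits q ((1 + altVal q j) / q) := by
  have h1 := h.neverSplits_next_of_mem hb (Or.inr ⟨_, by omega, rfl⟩)
  have hc := h.golden
  have h2 := h.altVal_pos (k + 2)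
  have h3 := h.altVal_strictAnti.antitone (show 2 ≤ k + 2 by omega)
  rw [h.sq_mul_altVal] at h1
  rcases h.neverSplits_cases h1 (by linarith) (by linarith [h.add_lt_gap, h.altVal_pos 4])
    with h4 | h4
  · rcases h4 with h4 | ⟨j, hj, h4⟩
    · linarith
    · exact ⟨j, hj, h4, h4 ▸ h1⟩
  · refine absurd ?_ (h.add_ne h.add_lt_gap (by linarith [h.gap_lt_add])
      (Or.inr ⟨k + 2, by omega, rfl⟩) h4)
    ring

theorem not_neverSplits_of_offset (h : IsSmallBase q) {d : ℝ} (h1 : q ^ 2 - q - 1 ≤ d)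
    (h2 : d < 1 / (q - 1) - 1 - altVal q 2) : ¬ NeverSplits q ((1 + d) / q) := by
  intro hb
  have hc := h.golden
  have hq := h.pos
  have hd : 0 < d := by linarith
  rcases h.neverSplits_cases hb hd.le (by linarith [h.altVal_pos 2]) with h3 | h3
  · rcases h3 with h3 | ⟨k, hk, h3⟩
    · linarith
    · have hk4 : 4 ≤ k := by
        by_contra! hk4
        have := h.altVal_strictAnti.antitone (show k ≤ 3 by omega)
        linarith [h.gap_lt_add]
      obtain ⟨k, rfl⟩ : ∃ m, k = m + 4 := ⟨k - 4, by omega⟩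
      rw [h3] at hb h1
      obtain ⟨j, -, hj, -⟩ := h.exists_next_index hb
      have h4 : altVal q (k + 2) < altVal q j := by linarith
      have h5 : altVal q j < altVal q (k + 1) := by
        rw [← hj, ← h.mul_altVal (k + 1), ← h.mul_altVal (k + 2), ← h.mul_altVal (k + 3)]
        have := h.altVal_pos (k + 4)
        have h6 : 0 < q * (q ^ 2 - q - 1) * altVal q (k + 4) := by
          have : 0 < q ^ 2 - q - 1 := by linarith
          positivity
        have h7 : 0 < (q - 1) * altVal q (k + 4) := mul_pos (by linarith [h.one_lt]) this
        nlinarith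
      rw [h.altVal_strictAnti.lt_iff_gt] at h4 h5
      omega
  · linarith [h.smallUniq_le h3]

theorem not_neverSplits_altVal_three (h : IsSmallBase q) :
    ¬ NeverSplits q ((1 + altVal q 3) / q) := by
  intro hb
  have hq := h.one_lt
  have hq0 := h.pos
  have hq1 : 0 < q - 1 := by linarith
  have h1 := h.neverSplits_next_of_mem hb (Or.inr ⟨3, by omega, rfl⟩)
  rw [h.sq_mul_altVal 1] at h1
  have h2 := h1.mul_sub_one_of_gt hq (by
    rw [lt_div_iff₀ hq0, div_mul_eq_mul_div, one_mul, div_mul_eq_div_div, div_self hq0.ne']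
    linarith [h.gap_lt_altVal_one, h.golden])
  refine h.not_neverSplits_of_offset (d := q * (q ^ 2 - q - 1) + altVal q 0 - 1)
    h.lt_small_offset.le ?_ ?_
  · refine lt_of_le_of_lt ?_ h.large_offset_lt
    have : 0 < (q - 1) * (q * (q ^ 2 - q - 1)) :=
      mul_pos hq1 (mul_pos hq0 (by linarith [h.golden]))
    linarith
  · convert h2 using 1
    rw [← h.mul_altVal 0]
    field_simp
    ring

theorem not_neverSplits_altVal_two (h : IsSmallBase q) :
    ¬ NeverSplits q ((1 + altVal q 2) / q) := by
  intro hb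
  have hq := h.one_lt
  have hq0 := h.pos
  have hq1 : 0 < q - 1 := by linarith
  have hc := h.golden
  have h1 := h.neverSplits_next_of_mem hb (Or.inr ⟨2, by omega, rfl⟩)
  rw [h.sq_mul_altVal 0] at h1
  have h2 := h1.mul_sub_one_of_gt hq (by
    rw [lt_div_iff₀ hq0, div_mul_eq_mul_div, one_mul, div_mul_eq_div_div, div_self hq0.ne']
    linarith [h.gap_lt_altVal_one, h.altVal_strictAnti one_pos])
  have h3 := h2.mul_sub_one_of_gt hq (by
    refine h.switch_lt_altVal_zero.trans ?_
    rw [mul_div_cancel₀ _ hq0.ne']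
    linarith)
  refine h.not_neverSplits_of_offset (d := q ^ 2 * (q ^ 2 - q - 1) + altVal q 0 - 1)
    ?_ h.large_offset_lt ?_
  · refine h.lt_small_offset.le.trans ?_
    have : 0 < (q - 1) * (q * (q ^ 2 - q - 1)) := mul_pos hq1 (mul_pos hq0 (by linarith))
    linarith
  · convert h3 using 1
    have h4 := h.altVal_one_eq
    have h5 := h.mul_altVal 0
    field_simp
    linear_combination (-q) * h4 - h5

theorem not_neverSplits_altVal (h : IsSmallBase q) (k : ℕ) (hk : 2 ≤ k) :
    ¬ NeverSplits q ((1 + altVal q k) / q) := by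
  induction k using Nat.strong_induction_on with
  | _ k ih =>
    intro hb
    by_cases hk4 : 4 ≤ k
    · obtain ⟨m, rfl⟩ : ∃ m, k = m + 4 := ⟨k - 4, by omega⟩
      obtain ⟨j, hj2, hj, hjb⟩ := h.exists_next_index hb
      refine ih j ?_ hj2 hjb
      have h1 : altVal q (m + 2) < altVal q j := by linarith [h.golden]
      rw [h.altVal_strictAnti.lt_iff_gt] at h1
      omega
    · obtain rfl | rfl : k = 2 ∨ k = 3 := by omega
      · exact h.not_neverSplits_altVal_two hb
      · exact h.not_neverSplits_altVal_three hb

theorem not_neverSplits_of_mem_smallUniq (h : IsSmallBase q) {d : ℝ} (hd : d ∈ smallUniq q) :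
    ¬ NeverSplits q ((1 + d) / q) := by
  intro hb
  have h1 := h.neverSplits_next_of_mem hb hd
  rcases hd with rfl | ⟨k, hk, rfl⟩
  · rw [mul_zero, add_zero] at h1
    exact h.not_neverSplits_of_offset le_rfl
      (by linarith [h.add_lt_gap, h.altVal_pos 4]) h1
  · exact h.not_neverSplits_altVal k hk hb

theorem not_neverSplits (h : IsSmallBase q) (x : ℝ) : ¬ NeverSplits q x := by
  intro hx
  have hq := h.one_lt
  have hq0 := h.pos
  have hq1 : q - 1 ≠ 0 := by linarith
  obtain ⟨y, hy, hb⟩ := hx.exists_mem_Sq hq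
  have h0 := (Tmap_mem_Iq_of_mem_Sq hq hy 0).2
  have h1 := (Tmap_mem_Iq_of_mem_Sq hq hy 1).1
  rw [Tmap_zero] at h0
  rw [Tmap_one] at h1
  have e : (1 + (q * y - 1)) / q = y := by
    field_simp
    ring
  rcases h.neverSplits_cases (e.symm ▸ hb) h1 (by linarith) with h2 | h2
  · exact h.not_neverSplits_of_mem_smallUniq h2 (e.symm ▸ hb)
  · refine h.not_neverSplits_of_mem_smallUniq h2 ?_
    convert hb.reflect hq using 1
    field_simp
    ring

theorem isUniq_altVal_zero (h : IsSmallBase q) : IsUniq q (altVal q 0) := by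
  have hq := h.one_lt
  have hq0 := h.pos
  have hq1 : 0 < q - 1 := by linarith
  have h0 := h.switch_lt_altVal_zero
  have h1 := h.altVal_one_lt_inv
  have hlt : altVal q 0 < 1 / (q - 1) := by
    have h4 := h.altVal_zero_eq
    have h5 : 0 < (q ^ 2 - q - 1) / (q ^ 2 - 1) :=
      div_pos (by linarith [h.golden]) h.sq_sub_one_pos
    have h6 : 1 < 1 / (q - 1) := by
      rw [lt_div_iff₀ hq1]
      linarith [h.lt_two]
    linarith
  rcases isUniq_or_isMulti hq h.lt_two
    (show altVal q 0 ∈ Iq q from ⟨(h.altVal_pos 0).le, hlt.le⟩) with hu | hm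
  · exact hu
  · exfalso
    obtain ⟨ε, h2, ε', h3, hne⟩ := hm
    obtain ⟨n, hn⟩ := Function.ne_iff.mp hne
    clear hne
    have first : ∀ η ∈ SigmaSet q (altVal q 0),
        η 0 = 1 ∧ tailSeq η ∈ SigmaSet q (altVal q 1) := by
      intro η hη
      have h4 := (mem_sigmaSet_iff_tail hq _ η).mp hη
      have h5 := mem_Iq_of_mem_sigmaSet hq h4
      have h6 := mul_gt_of_gt hq h0
      have h7 : η 0 = 1 := by
        generalize η 0 = d at *
        fin_cases d
        · have := h5.2
          simp only [Fin.zero_eta, Tmap_zero] at this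
          linarith
        · rfl
      rw [h7, Tmap_one, h.altVal_one_eq, add_sub_cancel_left] at h4
      exact ⟨h7, h4⟩
    have second : ∀ η ∈ SigmaSet q (altVal q 1),
        η 0 = 0 ∧ tailSeq η ∈ SigmaSet q (altVal q 0) := by
      intro η hη
      have h4 := (mem_sigmaSet_iff_tail hq _ η).mp hη
      have h5 := mem_Iq_of_mem_sigmaSet hq h4
      have h7 : η 0 = 0 := by
        generalize η 0 = d at *
        fin_cases d
        · rfl
        · have := h5.1
          rw [lt_div_iff₀ hq0] at h1
          simp only [Fin.mk_one, Tmap_one] at this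
          linarith
      rw [h7, Tmap_zero, h.mul_altVal] at h4
      exact ⟨h7, h4⟩
    induction n using Nat.strong_induction_on generalizing ε ε' with
    | _ n ih =>
      obtain ⟨a0, a1⟩ := first ε h2
      obtain ⟨b0, b1⟩ := first ε' h3
      obtain ⟨a2, a3⟩ := second _ a1
      obtain ⟨b2, b3⟩ := second _ b1
      match n with
      | 0 => exact hn (a0.trans b0.symm)
      | 1 => exact hn (a2.trans b2.symm)
      | n + 2 => exact ih n (by omega) _ a3 _ b3 hn

end IsSmallBase

theorem isSmallBase_of_mem_Ioo {q r : ℝ} (hq : q ∈ Ioo ((1 + Real.sqrt 5) / 2) r)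
    (hr : r ^ 6 = r ^ 4 + r ^ 3 + 2 * r ^ 2 + r + 1) : IsSmallBase q := by
  have h1 : Real.sqrt 5 ^ 2 = 5 := Real.sq_sqrt (by norm_num)
  have h2 : 2 < Real.sqrt 5 := Real.lt_sqrt_of_sq_lt (by norm_num)
  have h3 := hq.1
  exact ⟨by linarith, by nlinarith, sextic_lt_of_lt (by linarith) hq.2 hr.le⟩

/-- For `q ∈ ((1+√5)/2, q_{ℵ₀})` there is an `x ∈ (0,1/(q-1))` with uncountably
many `q`-expansions, there is an `x ∈ (0,1/(q-1))` with a unique `q`-expansion, and for every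
`x ∈ (0,1/(q-1))` the set `Σ_q(x)` is either uncountable or a singleton. -/
theorem dichotomy_below_qAleph0
    (qA : ℝ) (hqA1 : qA ∈ Set.Ioo (1 : ℝ) 2)
    (hqA2 : qA ^ 6 = qA ^ 4 + qA ^ 3 + 2 * qA ^ 2 + qA + 1)
    (q : ℝ) (hq : q ∈ Set.Ioo ((1 + Real.sqrt 5) / 2) qA) :
    (∃ x ∈ Set.Ioo (0 : ℝ) (1 / (q - 1)), ¬ (SigmaSet q x).Countable) ∧
    (∃ x ∈ Set.Ioo (0 : ℝ) (1 / (q - 1)), ∃! ε : ℕ → Fin 2, ε ∈ SigmaSet q x) ∧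
    (∀ x ∈ Set.Ioo (0 : ℝ) (1 / (q - 1)),
      ¬ (SigmaSet q x).Countable ∨ ∃ ε : ℕ → Fin 2, SigmaSet q x = {ε}) := by
  have h := isSmallBase_of_mem_Ioo hq hqA2
  have hq1 := h.one_lt
  have hq0 := h.pos
  have hq2 : 0 < q - 1 := by linarith
  have key : ∀ x, IsMulti q x → ¬ (SigmaSet q x).Countable := fun x hx =>
    not_countable_of_forall_not_neverSplits hq1 h.not_neverSplits hx
  have hlt : 1 < 1 / (q - 1) := by
    rw [lt_div_iff₀ hq2]
    linarith [h.lt_two]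
  have hinv : 1 / q < altVal q 0 := by
    rw [div_lt_iff₀ hq0, mul_comm, h.altVal_one_eq]
    linarith [h.altVal_pos 1]
  have hone : altVal q 0 < 1 := by
    have : altVal q 1 < 1 / q := h.altVal_one_lt_inv
    rw [lt_div_iff₀ hq0, mul_comm, h.mul_altVal] at this
    exact this
  refine ⟨⟨1 / q, ⟨by positivity, by linarith⟩, key _ ?_⟩,
    ⟨altVal q 0, ⟨h.altVal_pos 0, by linarith⟩, h.isUniq_altVal_zero⟩, fun x hx => ?_⟩
  · refine isMulti_of_mem_Sq hq1 h.lt_two ⟨le_rfl, ?_⟩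
    gcongr
    nlinarith [h.lt_two]
  · rcases isUniq_or_isMulti hq1 h.lt_two (Ioo_subset_Icc_self hx) with hu | hm
    · obtain ⟨ε, h1, h2⟩ := hu
      exact Or.inr ⟨ε, eq_singleton_iff_unique_mem.mpr ⟨h1, h2⟩⟩
    · exact Or.inl (key x hm)
end
end

section
/- Let q ∈ ((1+√5)/2, q_f]. If x ∈ I_q satisfies card Ω_q(x) > 1, then there exists a finite sequence of transformations a (a finite word in {T_{q,0}, T_{q,1}} whose partial compositions applied to x stay in I_q) such that a(x) ∈ J_q = [(q+q²)/(q⁴−1), (1+q³)/(q⁴−1)]. -/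
noncomputable section

open Set

/-- `y` is the image of `x` under a finite word whose partial compositions stay in `I_q`. -/
def Reachable (q x y : ℝ) : Prop :=
  ∃ a : List (Fin 2), (∀ k, k ≤ a.length → wordMap q (a.take k) x ∈ Iq q) ∧ wordMap q a x = y

theorem Reachable.refl {q x : ℝ} (hx : x ∈ Iq q) : Reachable q x x :=
  ⟨[], fun k _ => by simpa [wordMap] using hx, rfl⟩

theorem Reachable.step {q x y : ℝ} (h : Reachable q x y) (i : Fin 2)
    (hi : Tmap q i y ∈ Iq q) : Reachable q x (Tmap q i y) := by
  obtain ⟨a, ha, rfl⟩ := h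
  have happ : wordMap q (a ++ [i]) x = Tmap q i (wordMap q a x) := by simp [wordMap]
  refine ⟨a ++ [i], fun k hk => ?_, happ⟩
  rcases Nat.lt_or_ge a.length k with hlt | hle
  · rw [List.take_of_length_le (by simpa using hlt), happ]
    exact hi
  · rw [List.take_append_of_le_length hle]
    exact ha k hle

theorem applySeq_succ (a : ℕ → ℝ → ℝ) (n : ℕ) (x : ℝ) :
    applySeq a (n + 1) x = a n (applySeq a n x) := by
  simp [applySeq, List.range_succ]

theorem applySeq_congr {a b : ℕ → ℝ → ℝ} {n : ℕ} (h : ∀ m < n, a m = b m) (x : ℝ) :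
    applySeq a n x = applySeq b n x := by
  induction n with
  | zero => rfl
  | succ n ih =>
    rw [applySeq_succ, applySeq_succ, ih fun m hm => h m (by omega), h n (by omega)]

theorem reachable_applySeq {q x : ℝ} (hx : x ∈ Iq q) {a : ℕ → ℝ → ℝ} (ha : a ∈ OmegaSet q x)
    (n : ℕ) : Reachable q x (applySeq a n x) := by
  induction n with
  | zero => exact Reachable.refl hx
  | succ n ih =>
    have hmem := ha.2 n
    rw [applySeq_succ] at hmem ⊢
    rcases ha.1 n with h | h <;> rw [h] at hmem ⊢ <;> exact ih.step _ hmem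

/-- If `x` has two distinct orbits in `I_q`, then some orbit meets the switch region. -/
theorem exists_reachable_mem_Sq {q x : ℝ} (hq : 1 < q) (hx : x ∈ Iq q)
    (h : (OmegaSet q x).Nontrivial) : ∃ y ∈ Sq q, Reachable q x y := by
  classical
  obtain ⟨a, ha, b, hb, hab⟩ := h
  have hex : ∃ n, a n ≠ b n := Function.ne_iff.mp hab
  set n := Nat.find hex
  have hn : a n ≠ b n := Nat.find_spec hex
  have hlt : ∀ m < n, a m = b m := fun m hm => not_not.mp (Nat.find_min hex hm)
  refine ⟨applySeq a n x, ?_, reachable_applySeq hx ha n⟩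
  have hfa := ha.2 n
  have hfb := hb.2 n
  rw [applySeq_succ] at hfa hfb
  rw [← applySeq_congr hlt] at hfb
  generalize applySeq a n x = y at hfa hfb
  have key : Tmap q 0 y ∈ Iq q ∧ Tmap q 1 y ∈ Iq q := by
    rcases ha.1 n with h1 | h1 <;> rcases hb.1 n with h2 | h2
    · exact absurd (h1.trans h2.symm) hn
    · exact ⟨h1 ▸ hfa, h2 ▸ hfb⟩
    · exact ⟨h2 ▸ hfb, h1 ▸ hfa⟩
    · exact absurd (h1.trans h2.symm) hn
  rw [Tmap_zero, Tmap_one] at key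
  obtain ⟨⟨-, h0⟩, h1, -⟩ := key
  have hq0 : 0 < q := by linarith
  have hq1 : 0 < q - 1 := by linarith
  constructor
  · rw [div_le_iff₀ hq0]
    linarith
  · rw [le_div_iff₀ hq1] at h0
    rw [le_div_iff₀ (by positivity)]
    linarith

/-- Points slightly to the left of `J_q` are pushed into `J_q` by iterating `T_{q,1} ∘ T_{q,0}`,
whose repelling fixed point `1 / (q² - 1)` lies to their left. -/
theorem exists_mem_Jq_of_left {q : ℝ} (hq : 1 < q) {P : ℝ → Prop}
    (hP : ∀ y i, P y → Tmap q i y ∈ Iq q → P (Tmap q i y))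
    {y : ℝ} (hy : P y) (hl : 1 / (q ^ 2 - 1) < y) (hr : y < (q + q ^ 2) / (q ^ 4 - 1)) :
    ∃ z ∈ Jq q, P z := by
  have hq1 : 0 < q - 1 := by linarith
  have hq2 : 0 < q ^ 2 - 1 := by nlinarith
  have hq4 : 0 < q ^ 4 - 1 := by nlinarith
  set c := 1 / (q ^ 2 - 1) with hc
  set p := (q + q ^ 2) / (q ^ 4 - 1) with hp
  have hc0 : 0 < c := by positivity
  have hfix : q ^ 2 * c - 1 = c := by rw [hc]; field_simp; ring
  have hpr : q ^ 2 * p - 1 = (1 + q ^ 3) / (q ^ 4 - 1) := by rw [hp]; field_simp; ring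
  have hpI : q * p ≤ 1 / (q - 1) := by
    rw [hp, ← mul_div_assoc, div_le_div_iff₀ hq4 hq1]
    nlinarith
  have hrI : (1 + q ^ 3) / (q ^ 4 - 1) ≤ 1 / (q - 1) := by
    rw [div_le_div_iff₀ hq4 hq1]
    nlinarith [mul_pos hq1 (show 0 < q by linarith)]
  by_contra! hno
  have iter : ∀ n : ℕ, ∃ z, P z ∧ z < p ∧ c + (q ^ 2) ^ n * (y - c) ≤ z := by
    intro n
    induction n with
    | zero => exact ⟨y, hy, hr, by simp⟩
    | succ n ih =>
      obtain ⟨z, hz, hzp, hcz⟩ := ih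
      have hpow : 0 < (q ^ 2) ^ n * (y - c) := mul_pos (by positivity) (by linarith)
      have hz0 : 0 < z := by linarith
      have hz1 : P (q * z) := by
        rw [← Tmap_zero]
        refine hP z 0 hz ?_
        rw [Tmap_zero]
        exact ⟨by positivity, le_trans (by gcongr) hpI⟩
      have hlow : q ^ 2 * (c + (q ^ 2) ^ n * (y - c)) ≤ q ^ 2 * z := by gcongr
      have hupp : q ^ 2 * z ≤ q ^ 2 * p := by gcongr
      have hnext : c + (q ^ 2) ^ (n + 1) * (y - c) ≤ q ^ 2 * z - 1 := by
        rw [pow_succ]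
        linarith
      have hpos : 0 < (q ^ 2) ^ (n + 1) * (y - c) := mul_pos (by positivity) (by linarith)
      have hT : Tmap q 1 (q * z) = q ^ 2 * z - 1 := by rw [Tmap_one]; ring
      have hz2 : P (q ^ 2 * z - 1) := by
        rw [← hT]
        refine hP _ 1 hz1 ?_
        rw [hT]
        exact ⟨by linarith, by linarith⟩
      refine ⟨q ^ 2 * z - 1, hz2, ?_, hnext⟩
      by_contra! hge
      exact hno _ ⟨hge, by linarith⟩ hz2
  obtain ⟨n, hn⟩ := pow_unbounded_of_one_lt (p / (y - c)) (show 1 < q ^ 2 by linarith)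
  rw [div_lt_iff₀ (by linarith)] at hn
  obtain ⟨z, -, hzp, hcz⟩ := iter n
  linarith

/-- For `q ∈ ((1+√5)/2, q_f]` and `x ∈ I_q` with `card Ω_q(x) > 1`, some finite
sequence of transformations (with partial compositions staying in `I_q`) maps `x` into `J_q`. -/
theorem reach_Jq
    (qf : ℝ) (hqf1 : qf ∈ Set.Ioo (1 : ℝ) 2) (hqf2 : qf ^ 3 = 2 * qf ^ 2 - qf + 1)
    (q : ℝ) (hq : q ∈ Set.Ioc ((1 + Real.sqrt 5) / 2) qf)
    (x : ℝ) (hx : x ∈ Iq q) (hcard : (OmegaSet q x).Nontrivial) :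
    ∃ a : List (Fin 2),
      (∀ k, k ≤ a.length → wordMap q (a.take k) x ∈ Iq q) ∧ wordMap q a x ∈ Jq q := by
  have hφ : 1 < q * (q - 1) := by
    have h5 : Real.sqrt 5 < 2 * q - 1 := by linarith [hq.1]
    nlinarith [Real.sq_sqrt (show (0 : ℝ) ≤ 5 by norm_num), Real.sqrt_nonneg 5]
  have hq1 : 1 < q := by
    linarith [hq.1, (Real.lt_sqrt zero_le_one).2 (by norm_num : (1 : ℝ) ^ 2 < 5)]
  have hq0 : 0 < q := by linarith
  have hq1' : 0 < q - 1 := by linarith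
  have hq4 : 0 < q ^ 4 - 1 := by nlinarith
  have hc : 1 / (q ^ 2 - 1) < 1 / q := one_div_lt_one_div_of_lt hq0 (by linarith)
  suffices h : ∃ z ∈ Jq q, Reachable q x z by
    obtain ⟨z, hz, a, ha, rfl⟩ := h
    exact ⟨a, ha, hz⟩
  obtain ⟨y, ⟨hy1, hy2⟩, hy⟩ := exists_reachable_mem_Sq hq1 hx hcard
  by_cases hl : y < (q + q ^ 2) / (q ^ 4 - 1)
  · exact exists_mem_Jq_of_left hq1 (fun z i hz hi => hz.step i hi) hy (by linarith) hl
  by_cases hr : y ≤ (1 + q ^ 3) / (q ^ 4 - 1)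
  · exact ⟨y, ⟨not_lt.mp hl, hr⟩, hy⟩
  push Not at hl hr
  set L := 1 / (q - 1) with hL
  have hqL : q * L = L + 1 := by rw [hL]; field_simp; ring
  have hJ : (q + q ^ 2) / (q ^ 4 - 1) + (1 + q ^ 3) / (q ^ 4 - 1) = L := by
    rw [hL]; field_simp; ring
  have hS : 1 / (q * (q - 1)) = L - 1 / q := by rw [hL]; field_simp; ring
  have hrefl0 : ∀ z, L - Tmap q 0 z = Tmap q 1 (L - z) := fun z => by
    rw [Tmap_zero, Tmap_one]; linarith
  have hrefl1 : ∀ z, L - Tmap q 1 z = Tmap q 0 (L - z) := fun z => by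
    rw [Tmap_zero, Tmap_one]; linarith
  have hIrefl : ∀ z ∈ Iq q, L - z ∈ Iq q := fun z hz =>
    ⟨by linarith [hz.2], by linarith [hz.1]⟩
  obtain ⟨z, hz, hRz⟩ := exists_mem_Jq_of_left hq1 (P := fun z => Reachable q x (L - z))
    (y := L - y) (fun z i hz hi => by
      have hi' := hIrefl _ hi
      fin_cases i
      · simp only [Fin.zero_eta] at hi' ⊢
        rw [hrefl0] at hi' ⊢
        exact hz.step 1 hi'
      · simp only [Fin.mk_one] at hi' ⊢
        rw [hrefl1] at hi' ⊢
        exact hz.step 0 hi')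
    (by simpa using hy) (by linarith) (by linarith)
  exact ⟨L - z, ⟨by linarith [hz.2], by linarith [hz.1]⟩, hRz⟩
end
end

section
/- For q ∈ ((1+√5)/2, q_f], the interval J_q = [(q+q²)/(q⁴−1), (1+q³)/(q⁴−1)] is contained in the switch region S_q = [1/q, 1/(q(q−1))], with equality J_q = S_q if and only if q = q_f. -/
noncomputable section

open Set

/-- The left endpoint of `S_q` is at most that of `J_q` iff `q³ - 2q² + q - 1 ≤ 0`. -/
lemma one_div_le_left_endpoint_iff {q : ℝ} (hq : 1 < q) :
    1 / q ≤ (q + q ^ 2) / (q ^ 4 - 1) ↔ q ^ 3 - 2 * q ^ 2 + q - 1 ≤ 0 := by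
  have h4 : 0 < q ^ 4 - 1 := sub_pos.2 (one_lt_pow₀ hq (by norm_num))
  rw [div_le_div_iff₀ (by linarith) h4, ← sub_nonpos,
    show 1 * (q ^ 4 - 1) - (q + q ^ 2) * q = (q + 1) * (q ^ 3 - 2 * q ^ 2 + q - 1) by ring]
  exact ⟨fun h => nonpos_of_mul_nonpos_right h (by linarith),
    mul_nonpos_of_nonneg_of_nonpos (by linarith)⟩

/-- The left endpoint of `J_q` is at most that of `S_q` iff `0 ≤ q³ - 2q² + q - 1`. -/
lemma left_endpoint_le_one_div_iff {q : ℝ} (hq : 1 < q) :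
    (q + q ^ 2) / (q ^ 4 - 1) ≤ 1 / q ↔ 0 ≤ q ^ 3 - 2 * q ^ 2 + q - 1 := by
  have h4 : 0 < q ^ 4 - 1 := sub_pos.2 (one_lt_pow₀ hq (by norm_num))
  rw [div_le_div_iff₀ h4 (by linarith), ← sub_nonneg,
    show 1 * (q ^ 4 - 1) - (q + q ^ 2) * q = (q + 1) * (q ^ 3 - 2 * q ^ 2 + q - 1) by ring]
  exact mul_nonneg_iff_of_pos_left (by linarith)

/-- The difference of the right endpoints of `J_q` and `S_q`. -/
lemma right_endpoint_sub {q : ℝ} (hq : 1 < q) :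
    (1 + q ^ 3) / (q ^ 4 - 1) - 1 / (q * (q - 1)) =
      (q ^ 3 - 2 * q ^ 2 + q - 1) / (q * (q - 1) * (q ^ 2 + 1)) := by
  have h0 : q ≠ 0 := by linarith
  have h1 : q - 1 ≠ 0 := by linarith
  have h2 : q + 1 ≠ 0 := by linarith
  have h3 : q ^ 2 + 1 ≠ 0 := by positivity
  rw [show q ^ 4 - 1 = (q - 1) * (q + 1) * (q ^ 2 + 1) by ring]
  field_simp
  ring

/-- For `q ∈ ((1+√5)/2, q_f]`, `J_q ⊆ S_q`, with `J_q = S_q` iff `q = q_f`. -/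
theorem Jq_subset_switch_region
    (qf : ℝ) (hqf1 : qf ∈ Set.Ioo (1 : ℝ) 2) (hqf2 : qf ^ 3 = 2 * qf ^ 2 - qf + 1)
    (q : ℝ) (hq : q ∈ Set.Ioc ((1 + Real.sqrt 5) / 2) qf) :
    Jq q ⊆ Sq q ∧ (Jq q = Sq q ↔ q = qf) := by
  obtain ⟨hlo, hle⟩ := hq
  have h5 : (11 / 5 : ℝ) < √5 := Real.lt_sqrt_of_sq_lt (by norm_num)
  have hq1 : 8 / 5 < q := by linarith
  have hone : 1 < q := by linarith
  have hq2 : q < 2 := hle.trans_lt hqf1.2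
  have hfac : q ^ 3 - 2 * q ^ 2 + q - 1 =
      (q - qf) * (q ^ 2 + q * qf + qf ^ 2 - 2 * (q + qf) + 1) := by
    linear_combination hqf2
  have hpos : 0 < q ^ 2 + q * qf + qf ^ 2 - 2 * (q + qf) + 1 := by nlinarith
  have hp : q ^ 3 - 2 * q ^ 2 + q - 1 ≤ 0 :=
    hfac ▸ mul_nonpos_of_nonpos_of_nonneg (by linarith) hpos.le
  have hden : 0 < q * (q - 1) := mul_pos (by linarith) (by linarith)
  have hsub : Jq q ⊆ Sq q :=
    Icc_subset_Icc ((one_div_le_left_endpoint_iff hone).2 hp) <| sub_nonpos.1 <|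
      right_endpoint_sub hone ▸ div_nonpos_of_nonpos_of_nonneg hp (by positivity)
  refine ⟨hsub, fun h => le_antisymm hle ?_, fun h => hsub.antisymm ?_⟩
  · have hmem : 1 / q ∈ Sq q :=
      ⟨le_rfl, one_div_le_one_div_of_le hden (by nlinarith)⟩
    rw [← h] at hmem
    have hp' := (left_endpoint_le_one_div_iff hone).1 hmem.1
    rw [hfac] at hp'
    exact sub_nonneg.1 (nonneg_of_mul_nonneg_left hp' hpos)
  · have hp0 : q ^ 3 - 2 * q ^ 2 + q - 1 = 0 := by rw [hfac, h, sub_self, zero_mul]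
    refine Icc_subset_Icc ((left_endpoint_le_one_div_iff hone).2 hp0.ge) (sub_nonneg.1 ?_)
    rw [right_endpoint_sub hone, hp0, zero_div]
end
end

section
/- Let q ∈ ((1+√5)/2, q_{ℵ₀}). Then (T_{q,0}^{−1}(U_q) ∩ J_q) ∪ (T_{q,1}^{−1}(U_q) ∩ J_q) = {(01(10)^∞)_q, (011(10)^∞)_q, (10(01)^∞)_q, (100(01)^∞)_q}. -/
noncomputable section

open Set

section Expansions

variable {q x y z : ℝ} {i : Fin 2} {ε : ℕ → Fin 2}

lemma digit_nonneg (i : Fin 2) : (0 : ℝ) ≤ ((i : ℕ) : ℝ) := Nat.cast_nonneg _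

lemma digit_le_one (i : Fin 2) : ((i : ℕ) : ℝ) ≤ 1 := by
  fin_cases i <;> simp

lemma hasSum_one_div_pow_succ (hq : 1 < q) :
    HasSum (fun n : ℕ => 1 / q ^ (n + 1)) (1 / (q - 1)) := by
  have h0 : (0 : ℝ) < q := by linarith
  have h1 : q - 1 ≠ 0 := by linarith
  have h := (hasSum_geometric_of_lt_one (inv_nonneg.2 h0.le) (inv_lt_one_of_one_lt₀ hq)).mul_left q⁻¹
  have hv : q⁻¹ * (1 - q⁻¹)⁻¹ = 1 / (q - 1) := by
    rw [← mul_inv, mul_sub, mul_inv_cancel₀ h0.ne', mul_one, one_div]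
  rw [hv] at h
  refine h.congr_fun ?_
  intro n
  rw [pow_succ', one_div, mul_inv, inv_pow]

lemma summable_seqVal (hq : 1 < q) (ε : ℕ → Fin 2) :
    Summable (fun i : ℕ => ((ε i : ℕ) : ℝ) / q ^ (i + 1)) := by
  have h0 : (0 : ℝ) < q := by linarith
  refine Summable.of_nonneg_of_le (fun n => ?_) (fun n => ?_) (hasSum_one_div_pow_succ hq).summable
  · exact div_nonneg (digit_nonneg _) (by positivity)
  · exact div_le_div_of_nonneg_right (digit_le_one _) (by positivity)

lemma seqVal_mem_Iq (hq : 1 < q) (ε : ℕ → Fin 2) : seqVal q ε ∈ Iq q := by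
  have h0 : (0 : ℝ) < q := by linarith
  constructor
  · exact tsum_nonneg fun n => div_nonneg (digit_nonneg _) (by positivity)
  · rw [← (hasSum_one_div_pow_succ hq).tsum_eq]
    exact (summable_seqVal hq ε).tsum_le_tsum
      (fun n => div_le_div_of_nonneg_right (digit_le_one _) (by positivity))
      (hasSum_one_div_pow_succ hq).summable

lemma seqVal_eq_div (hq : 1 < q) (ε : ℕ → Fin 2) :
    seqVal q ε = (((ε 0 : ℕ) : ℝ) + seqVal q (fun n => ε (n + 1))) / q := by
  have h0 : (0 : ℝ) < q := by linarith
  unfold seqVal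
  rw [(summable_seqVal hq ε).tsum_eq_zero_add, add_div, ← tsum_div_const]
  congr 1
  · simp
  · refine tsum_congr fun n => ?_
    rw [div_div, ← pow_succ]

lemma Tmap_seqVal (hq : 1 < q) (ε : ℕ → Fin 2) :
    Tmap q (ε 0) (seqVal q ε) = seqVal q (fun n => ε (n + 1)) := by
  have h0 : q ≠ 0 := by linarith
  rw [seqVal_eq_div hq ε, Tmap, mul_div_cancel₀ _ h0]
  ring

/-- The digit sequence `i ε₀ ε₁ …`. -/
def consDigit (i : Fin 2) (ε : ℕ → Fin 2) : ℕ → Fin 2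
  | 0 => i
  | n + 1 => ε n

lemma consDigit_mem_SigmaSet (hq : 1 < q) (h : ε ∈ SigmaSet q (Tmap q i x)) :
    consDigit i ε ∈ SigmaSet q x := by
  have h0 : q ≠ 0 := by linarith
  have h' : Tmap q i x = seqVal q ε := h
  change x = seqVal q (consDigit i ε)
  rw [seqVal_eq_div hq]
  change x = (((i : ℕ) : ℝ) + seqVal q ε) / q
  rw [← h', Tmap]
  field_simp
  ring

lemma tail_mem_SigmaSet (hq : 1 < q) (h : ε ∈ SigmaSet q x) :
    (fun n => ε (n + 1)) ∈ SigmaSet q (Tmap q (ε 0) x) := by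
  have h' : x = seqVal q ε := h
  change Tmap q (ε 0) x = _
  rw [h', Tmap_seqVal hq]

/-- The orbit of `x` under the greedy algorithm. -/
def greedyOrbit (q x : ℝ) : ℕ → ℝ
  | 0 => x
  | n + 1 => Tmap q (if greedyOrbit q x n < 1 / q then 0 else 1) (greedyOrbit q x n)

lemma greedyOrbit_mem_Iq (hq : q ∈ Ioo (1 : ℝ) 2) (hx : x ∈ Iq q) (n : ℕ) :
    greedyOrbit q x n ∈ Iq q := by
  obtain ⟨h1, h2⟩ := hq
  have h0 : 0 < q := by linarith
  have hM : 1 / (q - 1) * (q - 1) = 1 := by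
    rw [div_mul_cancel₀]; linarith
  induction n with
  | zero => exact hx
  | succ n ih =>
    obtain ⟨ha, hb⟩ := ih
    simp only [greedyOrbit, Tmap]
    split_ifs with h
    · rw [lt_div_iff₀ h0] at h
      refine ⟨by simp; positivity, ?_⟩
      simp only [Fin.val_zero, Nat.cast_zero, sub_zero]
      nlinarith
    · rw [not_lt, div_le_iff₀ h0] at h
      refine ⟨by simp; nlinarith, ?_⟩
      simp only [Fin.val_one, Nat.cast_one]
      nlinarith

lemma SigmaSet_nonempty (hq : q ∈ Ioo (1 : ℝ) 2) (hx : x ∈ Iq q) : (SigmaSet q x).Nonempty := by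
  have h0 : 0 < q := by linarith [hq.1]
  set ε : ℕ → Fin 2 := fun n => if greedyOrbit q x n < 1 / q then 0 else 1 with hε
  refine ⟨ε, ?_⟩
  have hpart (n : ℕ) : ∑ i ∈ Finset.range n, ((ε i : ℕ) : ℝ) / q ^ (i + 1) =
      x - greedyOrbit q x n * (q⁻¹) ^ n := by
    induction n with
    | zero => simp [greedyOrbit]
    | succ n ih =>
      have hs : greedyOrbit q x (n + 1) = q * greedyOrbit q x n - ((ε n : ℕ) : ℝ) := rfl
      rw [Finset.sum_range_succ, ih, hs, inv_pow, inv_pow]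
      field_simp
      ring
  have hbd : Filter.Tendsto (fun n => greedyOrbit q x n * (q⁻¹) ^ n) Filter.atTop (nhds 0) := by
    have hg : Filter.Tendsto (fun n : ℕ => 1 / (q - 1) * (q⁻¹) ^ n) Filter.atTop (nhds 0) := by
      simpa using (tendsto_pow_atTop_nhds_zero_of_lt_one (inv_nonneg.2 h0.le)
        (inv_lt_one_of_one_lt₀ hq.1)).const_mul (1 / (q - 1))
    refine squeeze_zero (fun n => ?_) (fun n => ?_) hg
    · exact mul_nonneg (greedyOrbit_mem_Iq hq hx n).1 (by positivity)
    · exact mul_le_mul_of_nonneg_right (greedyOrbit_mem_Iq hq hx n).2 (by positivity)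
  have hsum : HasSum (fun i : ℕ => ((ε i : ℕ) : ℝ) / q ^ (i + 1)) x := by
    rw [hasSum_iff_tendsto_nat_of_nonneg
      (fun n => div_nonneg (digit_nonneg _) (by positivity))]
    simp only [hpart]
    simpa using hbd.const_sub x
  exact hsum.tsum_eq.symm

lemma Tmap_mem_UniqSet (hq : q ∈ Ioo (1 : ℝ) 2) (hx : x ∈ UniqSet q) (h : Tmap q i x ∈ Iq q) :
    Tmap q i x ∈ UniqSet q := by
  obtain ⟨ε, hε⟩ := SigmaSet_nonempty hq h
  refine ⟨h, ε, hε, fun δ hδ => ?_⟩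
  have := hx.2.unique (consDigit_mem_SigmaSet hq.1 hδ) (consDigit_mem_SigmaSet hq.1 hε)
  exact funext fun n => congrFun this (n + 1)

lemma notMem_Iq_of_mem_UniqSet (hq : q ∈ Ioo (1 : ℝ) 2) (hx : x ∈ UniqSet q)
    (h : Tmap q 0 x ∈ Iq q) : Tmap q 1 x ∉ Iq q := by
  intro h1
  obtain ⟨ε, hε⟩ := SigmaSet_nonempty hq h
  obtain ⟨δ, hδ⟩ := SigmaSet_nonempty hq h1
  have := hx.2.unique (consDigit_mem_SigmaSet hq.1 hε) (consDigit_mem_SigmaSet hq.1 hδ)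
  exact absurd (congrFun this 0) (by simp [consDigit])

lemma mem_UniqSet_of_Tmap (hq : 1 < q) (h : Tmap q i x ∈ UniqSet q)
    (hj : ∀ j, Tmap q j x ∈ Iq q → j = i) : x ∈ UniqSet q := by
  obtain ⟨-, ε, hε, hu⟩ := h
  have hmem := consDigit_mem_SigmaSet hq hε
  refine ⟨?_, _, hmem, fun δ hδ => ?_⟩
  · have : x = _ := hmem
    rw [this]
    exact seqVal_mem_Iq hq _
  · have ht := tail_mem_SigmaSet hq hδ
    have hδ0 : δ 0 = i := hj _ (by
      have : Tmap q (δ 0) x = _ := ht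
      rw [this]
      exact seqVal_mem_Iq hq _)
    rw [hδ0] at ht
    have := hu _ ht
    funext n
    cases n with
    | zero => exact hδ0
    | succ n => exact congrFun this n

lemma seqVal_rev (hq : 1 < q) (ε : ℕ → Fin 2) :
    seqVal q (fun n => (ε n).rev) = 1 / (q - 1) - seqVal q ε := by
  rw [← (hasSum_one_div_pow_succ hq).tsum_eq, seqVal, seqVal,
    ← (hasSum_one_div_pow_succ hq).summable.tsum_sub (summable_seqVal hq ε)]
  refine tsum_congr fun n => ?_
  rw [← sub_div]
  congr 1
  generalize ε n = j
  fin_cases j <;> simp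

lemma sub_mem_UniqSet (hq : 1 < q) (hx : x ∈ UniqSet q) : 1 / (q - 1) - x ∈ UniqSet q := by
  obtain ⟨⟨h0, h1⟩, ε, hε, hu⟩ := hx
  have hε' : x = _ := hε
  refine ⟨⟨by linarith, by linarith⟩, fun n => (ε n).rev, ?_, fun δ hδ => ?_⟩
  · change _ = _
    rw [seqVal_rev hq, ← hε']
  · have hδ' : _ - x = seqVal q δ := hδ
    have := hu (fun n => (δ n).rev) (by
      change _ = _
      rw [seqVal_rev hq, ← hδ']
      ring)
    funext n
    rw [← congrFun this n, Fin.rev_rev]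

end Expansions

section UniquePoints

variable {q x y : ℝ}

/-- Above the golden ratio, `(01)^∞` is a univoque sequence. -/
lemma one_div_sq_sub_one_mem_UniqSet (hq : q ∈ Ioo (1 : ℝ) 2) (hG : q + 1 < q ^ 2) :
    1 / (q ^ 2 - 1) ∈ UniqSet q := by
  obtain ⟨h1, h2⟩ := hq
  set a := 1 / (q ^ 2 - 1) with ha
  have ha1 : a * (q ^ 2 - 1) = 1 := by
    rw [ha, div_mul_cancel₀]; nlinarith
  have hM : 1 / (q - 1) = a * (q + 1) := by
    rw [ha]
    have : q - 1 ≠ 0 := by linarith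
    have : q ^ 2 - 1 ≠ 0 := by nlinarith
    field_simp
    ring
  have ha0 : 0 < a := by rw [ha]; apply one_div_pos.2; nlinarith
  have hI : a ∈ Iq q := ⟨ha0.le, by rw [hM]; nlinarith⟩
  have hstep (ε : ℕ → Fin 2) (hε : ε ∈ SigmaSet q a) :
      ε 0 = 0 ∧ ε 1 = 1 ∧ (fun n => ε (n + 2)) ∈ SigmaSet q a := by
    have ht := tail_mem_SigmaSet h1 hε
    have hmem : Tmap q (ε 0) a ∈ Iq q := by
      have : Tmap q (ε 0) a = _ := ht
      rw [this]; exact seqVal_mem_Iq h1 _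
    have h00 : ε 0 = 0 := by
      by_contra h
      rw [Fin.eq_one_of_ne_zero _ h] at hmem
      have := hmem.1
      simp only [Tmap, Fin.val_one, Nat.cast_one] at this
      nlinarith
    rw [h00] at ht
    have ht2 := tail_mem_SigmaSet h1 ht
    have hmem2 : Tmap q (ε 1) (Tmap q 0 a) ∈ Iq q := by
      have : Tmap q (ε 1) (Tmap q 0 a) = _ := ht2
      rw [this]; exact seqVal_mem_Iq h1 _
    have h11 : ε 1 = 1 := by
      by_contra h
      have h' : ε 1 = 0 := by
        by_contra h'
        exact h (Fin.eq_one_of_ne_zero _ h')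
      rw [h'] at hmem2
      have := hmem2.2
      rw [hM] at this
      simp only [Tmap, Fin.val_zero, Nat.cast_zero] at this
      nlinarith
    refine ⟨h00, h11, ?_⟩
    have hfix : Tmap q (ε 1) (Tmap q 0 a) = a := by
      rw [h11]
      simp only [Tmap, Fin.val_zero, Nat.cast_zero, Fin.val_one, Nat.cast_one]
      linarith
    change (fun n => ε (n + 2)) ∈ SigmaSet q (Tmap q (ε 1) (Tmap q 0 a)) at ht2
    rwa [hfix] at ht2
  have hdig (n : ℕ) : ∀ ε ∈ SigmaSet q a, ε (2 * n) = 0 ∧ ε (2 * n + 1) = 1 := by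
    induction n with
    | zero => exact fun ε hε => ⟨(hstep ε hε).1, (hstep ε hε).2.1⟩
    | succ n ih => exact fun ε hε => ih _ (hstep ε hε).2.2
  obtain ⟨ε, hε⟩ := SigmaSet_nonempty ⟨h1, h2⟩ hI
  refine ⟨hI, ε, hε, fun δ hδ => funext fun n => ?_⟩
  obtain ⟨k, rfl | rfl⟩ := Nat.even_or_odd' n
  · rw [(hdig k δ hδ).1, (hdig k ε hε).1]
  · rw [(hdig k δ hδ).2, (hdig k ε hε).2]

lemma mul_mem_UniqSet (hq : q ∈ Ioo (1 : ℝ) 2) (hx : x ∈ UniqSet q) (h : q * x < 1) :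
    q * x ∈ UniqSet q := by
  obtain ⟨h1, h2⟩ := hq
  have hT : Tmap q 0 x = q * x := by simp [Tmap]
  have : Tmap q 0 x ∈ Iq q := by
    rw [hT]
    refine ⟨mul_nonneg (by linarith) hx.1.1, h.le.trans ?_⟩
    rw [le_div_iff₀] <;> linarith
  rw [← hT]
  exact Tmap_mem_UniqSet ⟨h1, h2⟩ hx this

/-- A univoque point with `1 ≤ q x` lies to the right of the switch region. -/
lemma lt_mul_and_sub_mem_UniqSet (hq : q ∈ Ioo (1 : ℝ) 2) (hx : x ∈ UniqSet q) (h : 1 ≤ q * x) :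
    1 / (q - 1) < q * x ∧ q * x - 1 ∈ UniqSet q := by
  have hM : 1 / (q - 1) * (q - 1) = 1 := by
    rw [div_mul_cancel₀]; linarith [hq.1]
  have hT : Tmap q 1 x = q * x - 1 := by simp [Tmap]
  have hx1 := hx.1.2
  have hmem : Tmap q 1 x ∈ Iq q := by
    rw [hT]
    exact ⟨by linarith, by nlinarith [hq.1]⟩
  refine ⟨?_, hT ▸ Tmap_mem_UniqSet hq hx hmem⟩
  by_contra! h'
  refine notMem_Iq_of_mem_UniqSet hq hx ?_ hmem
  simp only [Tmap, Fin.val_zero, Nat.cast_zero, sub_zero]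
  exact ⟨by linarith, h'⟩

/-- The only univoque point strictly between `1/(q-1) - 1` and `1/q` is `(01)^∞`. -/
lemma eq_of_mem_UniqSet (hq : q ∈ Ioo (1 : ℝ) 2) (hG : q + 1 < q ^ 2)
    (hf : q * (q - 1) ^ 2 < 1) (hx : x ∈ UniqSet q) (h0 : 1 / (q - 1) - 1 < x)
    (h1 : q * x < 1) : x * (q ^ 2 - 1) = 1 := by
  have hq1 := hq.1
  have hM : 1 / (q - 1) * (q - 1) = 1 := by
    rw [div_mul_cancel₀]; linarith
  have hM1 : 1 < 1 / (q - 1) := by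
    rw [lt_div_iff₀] <;> linarith [hq.2]
  set M := 1 / (q - 1) with hMdef
  have hstep : ∀ y ∈ UniqSet q, M - 1 < y → q * y < 1 →
      q ^ 2 * y - 1 ∈ UniqSet q ∧ M - 1 < q ^ 2 * y - 1 ∧ q * (q ^ 2 * y - 1) < 1 := by
    intro y hy ha hb
    have hqy := mul_mem_UniqSet hq hy hb
    have hge : 1 ≤ q * (q * y) := by
      have h3 : q ^ 2 * (M - 1) ≤ q ^ 2 * y := by nlinarith [sq_nonneg q]
      have h4 : (q ^ 2 * (M - 1) - 1) * (q - 1) = 1 - q * (q - 1) ^ 2 := by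
        linear_combination q ^ 2 * hM
      have h5 : 0 < q ^ 2 * (M - 1) - 1 := by
        by_contra! h; nlinarith
      nlinarith
    obtain ⟨h6, h7⟩ := lt_mul_and_sub_mem_UniqSet hq hqy hge
    have he : q * (q * y) - 1 = q ^ 2 * y - 1 := by ring
    rw [he] at h7
    refine ⟨h7, by linarith, ?_⟩
    by_contra! h8
    have h9 := (lt_mul_and_sub_mem_UniqSet hq h7 h8).1
    have h10 : q * (q ^ 2 * y - 1) ≤ q * (q - 1) := by nlinarith
    have h11 : M < q * (q - 1) := by linarith
    nlinarith
  have hiter (n : ℕ) : ∃ y ∈ UniqSet q, M - 1 < y ∧ q * y < 1 ∧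
      y * (q ^ 2 - 1) - 1 = (q ^ 2) ^ n * (x * (q ^ 2 - 1) - 1) := by
    induction n with
    | zero => exact ⟨x, hx, h0, h1, by simp⟩
    | succ n ih =>
      obtain ⟨y, hy, ha, hb, hc⟩ := ih
      obtain ⟨ha', hb', hc'⟩ := hstep y hy ha hb
      refine ⟨_, ha', hb', hc', ?_⟩
      rw [pow_succ]
      linear_combination q ^ 2 * hc
  by_contra hne
  have hpos : 0 < |x * (q ^ 2 - 1) - 1| := abs_pos.2 (sub_ne_zero.2 hne)
  obtain ⟨n, hn⟩ := pow_unbounded_of_one_lt (q ^ 2 / |x * (q ^ 2 - 1) - 1|)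
    (show 1 < q ^ 2 by linarith)
  rw [div_lt_iff₀ hpos] at hn
  obtain ⟨y, -, ha, hb, hc⟩ := hiter n
  have := congrArg abs hc
  rw [abs_mul, abs_of_nonneg (by positivity : (0 : ℝ) ≤ (q ^ 2) ^ n)] at this
  rw [← this] at hn
  have hle : |y * (q ^ 2 - 1) - 1| ≤ q ^ 2 := by
    have hy0 : 0 < y := by linarith
    have hy1 : y < 1 := by nlinarith
    rw [abs_le]
    constructor <;> nlinarith
  linarith

/-- A point of `J_q` whose image under `T_{q,0}` is univoque is `01(10)^∞` or `011(10)^∞`. -/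
lemma eq_or_eq_of_mul_mem_UniqSet (hq : q ∈ Ioo (1 : ℝ) 2) (hG : q + 1 < q ^ 2)
    (hf : q * (q - 1) ^ 2 < 1) (hA : q ^ 6 < q ^ 4 + q ^ 3 + 2 * q ^ 2 + q + 1)
    (hx : x ∈ Jq q) (hU : q * x ∈ UniqSet q) :
    q ^ 2 * x - 1 = q * (1 / (q ^ 2 - 1)) ∨ q ^ 3 * x - q - 1 = q * (1 / (q ^ 2 - 1)) := by
  obtain ⟨h1, h2⟩ := hq
  have hq' : q ∈ Ioo (1 : ℝ) 2 := ⟨h1, h2⟩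
  have hD1 : 0 < q ^ 2 - 1 := by nlinarith
  obtain ⟨hl, hr⟩ := hx
  have hD : 0 < q ^ 4 - 1 := by nlinarith
  rw [div_le_iff₀ hD] at hl
  rw [le_div_iff₀ hD] at hr
  set a := 1 / (q ^ 2 - 1) with ha
  have ha1 : a * (q ^ 2 - 1) = 1 := by
    rw [ha, div_mul_cancel₀]; nlinarith
  have huniq {y : ℝ} (hy : y * (q ^ 2 - 1) = 1) : y = a := by
    rw [ha, eq_div_iff hD1.ne', hy]
  have hy1 : 1 ≤ q * (q * x) := by
    by_contra! h
    nlinarith [pow_pos (by linarith : 0 < q) 3]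
  obtain ⟨hb1, hU1⟩ := lt_mul_and_sub_mem_UniqSet hq' hU hy1
  rcases lt_or_ge (q * (q * (q * x) - 1)) 1 with hc | hc
  · exfalso
    have := eq_of_mem_UniqSet hq' hG hf hU1 (by linarith) hc
    nlinarith
  obtain ⟨hb2, hU2⟩ := lt_mul_and_sub_mem_UniqSet hq' hU1 hc
  rcases lt_or_ge (q * (q * (q * (q * x) - 1) - 1)) 1 with hc | hc
  · left
    have := huniq (eq_of_mem_UniqSet hq' hG hf hU2 (by linarith) hc)
    have h3 : q * (q ^ 2 * x - 1 - q * a) = 0 := by linear_combination this - ha1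
    rcases mul_eq_zero.1 h3 with h | h <;> linarith
  right
  obtain ⟨hb3, hU3⟩ := lt_mul_and_sub_mem_UniqSet hq' hU2 hc
  set y₃ := q * (q * (q * (q * x) - 1) - 1) - 1 with hy₃
  rcases lt_or_ge (q * y₃) 1 with hc | hc
  · have := huniq (eq_of_mem_UniqSet hq' hG hf hU3 (by linarith) hc)
    have h3 : q * (q ^ 3 * x - q - 1 - q * a) = 0 := by linear_combination this - ha1
    rcases mul_eq_zero.1 h3 with h | h <;> linarith
  exfalso
  have hM : 1 / (q - 1) = a * (q + 1) := by
    rw [ha]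
    have : q - 1 ≠ 0 := by linarith
    field_simp
    ring
  have hlt : y₃ < q * a := by
    have h4 : y₃ * (q ^ 4 - 1) < q * a * (q ^ 4 - 1) := by
      have h5 : q * a * (q ^ 4 - 1) = q * (q ^ 2 + 1) := by
        linear_combination q * (q ^ 2 + 1) * ha1
      have h6 : y₃ * (q ^ 4 - 1) =
          q ^ 4 * (x * (q ^ 4 - 1)) - (q ^ 2 + q + 1) * (q ^ 4 - 1) := by
        rw [hy₃]; ring
      have h7 : q ^ 4 * (x * (q ^ 4 - 1)) ≤ q ^ 4 * (1 + q ^ 3) :=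
        mul_le_mul_of_nonneg_left hr (by positivity)
      have h8 : (q - 1) * (q ^ 6 - (q ^ 4 + q ^ 3 + 2 * q ^ 2 + q + 1)) < 0 :=
        mul_neg_of_pos_of_neg (by linarith) (by linarith)
      rw [h5, h6]
      nlinarith
    exact lt_of_mul_lt_mul_right h4 hD.le
  obtain ⟨hb4, hU4⟩ := lt_mul_and_sub_mem_UniqSet hq' hU3 hc
  rcases lt_or_ge (q * (q * y₃ - 1)) 1 with hc | hc
  · have := huniq (eq_of_mem_UniqSet hq' hG hf hU4 (by linarith) hc)
    have h3 : q * (y₃ - q * a) = 0 := by linear_combination this - ha1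
    rcases mul_eq_zero.1 h3 with h | h <;> linarith
  · obtain ⟨hb5, -⟩ := lt_mul_and_sub_mem_UniqSet hq' hU4 hc
    have ha0 : 0 < a := one_div_pos.2 hD1
    nlinarith [mul_lt_mul_of_pos_left hlt (by positivity : 0 < q ^ 2)]

lemma mem_UniqSet_of_lt (hq : 1 < q) (h : q * x - 1 ∈ UniqSet q) (h' : 1 / (q - 1) < q * x) :
    x ∈ UniqSet q := by
  have hT : Tmap q 1 x = q * x - 1 := by simp [Tmap]
  refine mem_UniqSet_of_Tmap hq (hT ▸ h) fun j hj => ?_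
  by_contra hne
  have hj0 : j = 0 := by
    by_contra h0
    exact hne (Fin.eq_one_of_ne_zero _ h0)
  rw [hj0] at hj
  have := hj.2
  simp only [Tmap, Fin.val_zero, Nat.cast_zero, sub_zero] at this
  linarith

lemma mem_Jq_and_mul_mem_UniqSet (hq : q ∈ Ioo (1 : ℝ) 2) (hG : q + 1 < q ^ 2)
    (hx : q ^ 2 * x - 1 = q * (1 / (q ^ 2 - 1)) ∨
      q ^ 3 * x - q - 1 = q * (1 / (q ^ 2 - 1))) :
    x ∈ Jq q ∧ q * x ∈ UniqSet q := by
  have haU := one_div_sq_sub_one_mem_UniqSet hq hG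
  obtain ⟨h1, h2⟩ := hq
  have hD1 : 0 < q ^ 2 - 1 := by nlinarith
  have hD : 0 < q ^ 4 - 1 := by nlinarith
  have h0 : 0 < q := by linarith
  have hM : 1 / (q - 1) = 1 / (q ^ 2 - 1) * (q + 1) := by
    have : q - 1 ≠ 0 := by linarith
    field_simp
    ring
  set a := 1 / (q ^ 2 - 1) with ha
  have ha1 : a * (q ^ 2 - 1) = 1 := by
    rw [ha, div_mul_cancel₀]; nlinarith
  have ha0 : 0 < a := one_div_pos.2 hD1
  have hb : q * a < 1 := by nlinarith
  have haq : a < 1 := by nlinarith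
  have hbU := mul_mem_UniqSet ⟨h1, h2⟩ haU hb
  have hqa : q * a * (q ^ 4 - 1) = q * (q ^ 2 + 1) := by
    linear_combination q * (q ^ 2 + 1) * ha1
  have h3 : q ^ 2 + q < q ^ 3 := by nlinarith
  have h4 : q ^ 3 + q ^ 2 < q ^ 4 := by nlinarith
  have h5 : q ^ 4 + q ^ 3 < q ^ 5 := by nlinarith
  have h6 : q ^ 5 + q ^ 4 < q ^ 6 := by nlinarith
  rcases hx with hx | hx
  · have hx' : q ^ 2 * (x * (q ^ 4 - 1)) = q ^ 4 + q ^ 3 + q - 1 := by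
      linear_combination (q ^ 4 - 1) * hx + hqa
    refine ⟨⟨?_, ?_⟩, ?_⟩
    · rw [div_le_iff₀ hD]
      exact le_of_mul_le_mul_left (by nlinarith) (by positivity : 0 < q ^ 2)
    · rw [le_div_iff₀ hD]
      exact le_of_mul_le_mul_left (by nlinarith) (by positivity : 0 < q ^ 2)
    · have hy : q * (q * x) = 1 + q * a := by linear_combination hx
      refine mem_UniqSet_of_lt h1 ?_ ?_
      · rwa [hy, add_sub_cancel_left]
      · rw [hy, hM]; linarith
  · have hx' : q ^ 3 * (x * (q ^ 4 - 1)) = q ^ 5 + q ^ 4 + q ^ 3 - 1 := by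
      linear_combination (q ^ 4 - 1) * hx + hqa
    refine ⟨⟨?_, ?_⟩, ?_⟩
    · rw [div_le_iff₀ hD]
      exact le_of_mul_le_mul_left (by nlinarith) (by positivity : 0 < q ^ 3)
    · rw [le_div_iff₀ hD]
      exact le_of_mul_le_mul_left (by nlinarith) (by positivity : 0 < q ^ 3)
    · have hy : q * (q * (q * x) - 1) = 1 + q * a := by linear_combination hx
      have hz : q * a < q * (q * x) - 1 := by
        refine lt_of_mul_lt_mul_left (a := q) ?_ h0.le
        rw [hy]; nlinarith
      refine mem_UniqSet_of_lt h1 (mem_UniqSet_of_lt h1 ?_ ?_) ?_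
      · rwa [hy, add_sub_cancel_left]
      · rw [hy, hM]; linarith
      · rw [hM]; linarith

lemma preimage_zero_eq (hq : q ∈ Ioo (1 : ℝ) 2) (hG : q + 1 < q ^ 2)
    (hf : q * (q - 1) ^ 2 < 1) (hA : q ^ 6 < q ^ 4 + q ^ 3 + 2 * q ^ 2 + q + 1) :
    x ∈ Tmap q 0 ⁻¹' UniqSet q ∩ Jq q ↔
      q ^ 2 * x - 1 = q * (1 / (q ^ 2 - 1)) ∨ q ^ 3 * x - q - 1 = q * (1 / (q ^ 2 - 1)) := by
  have hT : Tmap q 0 x = q * x := by simp [Tmap]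
  rw [mem_inter_iff, mem_preimage, hT]
  exact ⟨fun h => eq_or_eq_of_mul_mem_UniqSet hq hG hf hA h.2 h.1,
    fun h => (mem_Jq_and_mul_mem_UniqSet hq hG h).symm⟩

lemma sub_mem_UniqSet_iff (hq : 1 < q) : 1 / (q - 1) - x ∈ UniqSet q ↔ x ∈ UniqSet q :=
  ⟨fun h => by simpa using sub_mem_UniqSet hq h, sub_mem_UniqSet hq⟩

lemma sub_mem_Jq_iff (hq : 1 < q) : 1 / (q - 1) - x ∈ Jq q ↔ x ∈ Jq q := by
  have h2 : 1 < q ^ 2 := by nlinarith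
  have h : 1 / (q - 1) = (q + q ^ 2) / (q ^ 4 - 1) + (1 + q ^ 3) / (q ^ 4 - 1) := by
    have h3 : q - 1 ≠ 0 := by linarith
    have h4 : q ^ 4 - 1 ≠ 0 := by nlinarith
    field_simp
    ring
  rw [h]
  constructor <;> rintro ⟨h3, h4⟩ <;> constructor <;> linarith

lemma mem_preimage_one_iff (hq : 1 < q) :
    x ∈ Tmap q 1 ⁻¹' UniqSet q ∩ Jq q ↔
      1 / (q - 1) - x ∈ Tmap q 0 ⁻¹' UniqSet q ∩ Jq q := by
  have hM : 1 / (q - 1) * (q - 1) = 1 := by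
    rw [div_mul_cancel₀]; linarith
  have hT : Tmap q 0 (1 / (q - 1) - x) = 1 / (q - 1) - Tmap q 1 x := by
    simp only [Tmap, Fin.val_zero, Nat.cast_zero, Fin.val_one, Nat.cast_one]
    linear_combination hM
  rw [mem_inter_iff, mem_inter_iff, mem_preimage, mem_preimage, hT, sub_mem_UniqSet_iff hq,
    sub_mem_Jq_iff hq]

end UniquePoints

section PeriodicValues

variable {q : ℝ}

lemma seqVal_uwInf_cons (hq : 1 < q) (i : Fin 2) (u w : List (Fin 2)) :
    seqVal q (uwInf (i :: u) w) = (((i : ℕ) : ℝ) + seqVal q (uwInf u w)) / q := by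
  rw [seqVal_eq_div hq]
  have h : (fun n => uwInf (i :: u) w (n + 1)) = uwInf u w := by
    funext n
    simp [uwInf]
  rw [h]
  simp [uwInf]

lemma uwInf_nil_pair_succ (i j : Fin 2) :
    (fun n => uwInf [] [i, j] (n + 1)) = uwInf [] [j, i] := by
  funext n
  obtain ⟨k, rfl | rfl⟩ := Nat.even_or_odd' n
  · simp [uwInf, Nat.add_mod]
  · have h1 : (2 * k + 1 + 1) % 2 = 0 := by omega
    simp [uwInf, h1, Nat.add_mod]

lemma seqVal_alternating (hq : 1 < q) :
    seqVal q (uwInf [] [0, 1]) = 1 / (q ^ 2 - 1) ∧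
      seqVal q (uwInf [] [1, 0]) = q * (1 / (q ^ 2 - 1)) := by
  have h0 : 0 < q := by linarith
  have h2 : q ^ 2 - 1 ≠ 0 := by nlinarith
  have hA := seqVal_eq_div hq (uwInf [] [0, 1])
  have hB := seqVal_eq_div hq (uwInf [] [1, 0])
  rw [uwInf_nil_pair_succ, eq_div_iff h0.ne'] at hA hB
  have h01 : uwInf [] [0, 1] 0 = 0 := rfl
  have h10 : uwInf [] [1, 0] 0 = 1 := rfl
  rw [h01, Fin.val_zero, Nat.cast_zero] at hA
  rw [h10, Fin.val_one, Nat.cast_one] at hB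
  have hv : seqVal q (uwInf [] [0, 1]) = 1 / (q ^ 2 - 1) := by
    rw [eq_div_iff h2]
    linear_combination q * hA + hB
  refine ⟨hv, ?_⟩
  rw [← hv]
  linarith

end PeriodicValues

lemma add_one_lt_sq_of_goldenRatio_lt {q : ℝ} (h : (1 + Real.sqrt 5) / 2 < q) :
    q + 1 < q ^ 2 := by
  nlinarith [Real.sq_sqrt (show (0 : ℝ) ≤ 5 by norm_num), Real.sqrt_nonneg 5]

lemma pow_six_lt_of_lt_root {q r : ℝ} (h0 : 0 < q) (h : q < r)
    (hr : r ^ 6 = r ^ 4 + r ^ 3 + 2 * r ^ 2 + r + 1) :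
    q ^ 6 < q ^ 4 + q ^ 3 + 2 * q ^ 2 + q + 1 := by
  have hr0 : 0 < r := h0.trans h
  have key (k l : ℕ) (hl : l ≠ 0) : q ^ (k + l) * r ^ k < r ^ (k + l) * q ^ k := by
    have : q ^ l < r ^ l := pow_lt_pow_left₀ h h0.le hl
    rw [pow_add, pow_add]
    calc q ^ k * q ^ l * r ^ k = q ^ k * r ^ k * q ^ l := by ring
      _ < q ^ k * r ^ k * r ^ l := mul_lt_mul_of_pos_left this (by positivity)
      _ = r ^ k * r ^ l * q ^ k := by ring
  refine lt_of_mul_lt_mul_left (a := r ^ 6) ?_ (by positivity)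
  have h1 : r ^ 6 * q ^ 6 = q ^ 6 * (r ^ 4 + r ^ 3 + 2 * r ^ 2 + r + 1) := by
    rw [← hr]; ring
  rw [h1]
  have k4 : q ^ 6 * r ^ 4 < r ^ 6 * q ^ 4 := key 4 2 (by simp)
  have k3 : q ^ 6 * r ^ 3 < r ^ 6 * q ^ 3 := key 3 3 (by simp)
  have k2 : q ^ 6 * r ^ 2 < r ^ 6 * q ^ 2 := key 2 4 (by simp)
  have k1 : q ^ 6 * r ^ 1 < r ^ 6 * q ^ 1 := key 1 5 (by simp)
  have k0 : q ^ 6 * r ^ 0 < r ^ 6 * q ^ 0 := key 0 6 (by simp)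
  linarith

lemma mul_sub_one_sq_lt_one {q : ℝ} (h1 : 1 < q)
    (hA : q ^ 6 < q ^ 4 + q ^ 3 + 2 * q ^ 2 + q + 1) : q * (q - 1) ^ 2 < 1 := by
  have h : q < 17 / 10 := by
    by_contra! h
    have h2 : 17 / 10 * q ≤ q ^ 2 := by nlinarith
    have h3 : 17 / 10 * q ^ 2 ≤ q ^ 3 := by nlinarith
    have h4 : 17 / 10 * q ^ 3 ≤ q ^ 4 := by nlinarith
    have h5 : 17 / 10 * q ^ 4 ≤ q ^ 5 := by nlinarith
    have h6 : 17 / 10 * q ^ 5 ≤ q ^ 6 := by nlinarith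
    linarith
  have : (q - 1) ^ 2 ≤ (7 / 10) ^ 2 := pow_le_pow_left₀ (by linarith) (by linarith) 2
  nlinarith


/-- For `q ∈ ((1+√5)/2, q_{ℵ₀})`,
`(T_{q,0}⁻¹(U_q) ∩ J_q) ∪ (T_{q,1}⁻¹(U_q) ∩ J_q)` consists of the four points
`(01(10)^∞)_q, (011(10)^∞)_q, (10(01)^∞)_q, (100(01)^∞)_q`. -/
theorem preimages_of_unique_points_in_Jq
    (qA : ℝ) (hqA1 : qA ∈ Set.Ioo (1 : ℝ) 2)
    (hqA2 : qA ^ 6 = qA ^ 4 + qA ^ 3 + 2 * qA ^ 2 + qA + 1)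
    (q : ℝ) (hq : q ∈ Set.Ioo ((1 + Real.sqrt 5) / 2) qA) :
    (Tmap q 0 ⁻¹' UniqSet q ∩ Jq q) ∪ (Tmap q 1 ⁻¹' UniqSet q ∩ Jq q) =
      {seqVal q (uwInf [0, 1] [1, 0]), seqVal q (uwInf [0, 1, 1] [1, 0]),
       seqVal q (uwInf [1, 0] [0, 1]), seqVal q (uwInf [1, 0, 0] [0, 1])} := by
  have hG := add_one_lt_sq_of_goldenRatio_lt hq.1
  have h0 : 0 < q := by
    have := Real.sqrt_nonneg 5
    linarith [hq.1]
  have h1 : 1 < q := by nlinarith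
  have hq2 : q ∈ Ioo (1 : ℝ) 2 := ⟨h1, hq.2.trans hqA1.2⟩
  have hA := pow_six_lt_of_lt_root h0 hq.2 hqA2
  have hf := mul_sub_one_sq_lt_one h1 hA
  have hD : 0 < q ^ 2 - 1 := by linarith
  have hM : 1 / (q - 1) = 1 / (q ^ 2 - 1) * (q + 1) := by
    have : q - 1 ≠ 0 := by linarith
    field_simp
    ring
  ext x
  rw [mem_union, mem_preimage_one_iff h1, preimage_zero_eq hq2 hG hf hA,
    preimage_zero_eq hq2 hG hf hA, hM]
  simp only [mem_insert_iff, mem_singleton_iff, seqVal_uwInf_cons h1,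
    (seqVal_alternating h1).1, (seqVal_alternating h1).2, Fin.val_zero, Fin.val_one,
    Nat.cast_zero, Nat.cast_one]
  have ha1 : 1 / (q ^ 2 - 1) * (q ^ 2 - 1) = 1 := div_mul_cancel₀ _ hD.ne'
  generalize 1 / (q ^ 2 - 1) = a at ha1 ⊢
  rw [or_assoc]
  refine or_congr ?_ (or_congr ?_ (or_congr ?_ ?_))
  · field_simp
    constructor <;> intro h <;> linarith
  · field_simp
    constructor <;> intro h <;> linarith
  · field_simp
    constructor <;> intro h <;> linear_combination -h + (q + 1) * ha1
  · field_simp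
    constructor <;> intro h <;> linear_combination -h + (q ^ 2 + q + 1) * ha1
end
end

section
/- Let q = q_{ℵ₀}. Then T_{q,0}((1+q³)/(q⁴−1)) = (111(10)^∞)_q and T_{q,1}((q+q²)/(q⁴−1)) = (000(01)^∞)_q. -/
noncomputable section

open Set

/-- The value of a purely periodic sequence of digits with period two. -/
theorem hasSum_digits_period_two {q : ℝ} (hq : 1 < q) (d : ℕ → ℝ) (a b : ℝ)
    (hd0 : ∀ k, d (2 * k) = a) (hd1 : ∀ k, d (2 * k + 1) = b) :
    HasSum (fun i => d i / q ^ (i + 1)) ((a * q + b) / (q ^ 2 - 1)) := by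
  have hq0 : q ≠ 0 := (zero_lt_one.trans hq).ne'
  have hq2 : q ^ 2 - 1 ≠ 0 := (sub_pos.2 (one_lt_pow₀ hq two_ne_zero)).ne'
  have hgeom : HasSum (fun k : ℕ => ((q ^ 2)⁻¹) ^ k) (1 - (q ^ 2)⁻¹)⁻¹ :=
    hasSum_geometric_of_lt_one (by positivity) (inv_lt_one_of_one_lt₀ (by nlinarith))
  have hinv : (1 - (q ^ 2)⁻¹)⁻¹ = q ^ 2 / (q ^ 2 - 1) := by
    rw [show 1 - (q ^ 2)⁻¹ = (q ^ 2 - 1) / q ^ 2 by field_simp, inv_div]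
  rw [hinv] at hgeom
  have heven : HasSum (fun k => d (2 * k) / q ^ (2 * k + 1))
      (a / q * (q ^ 2 / (q ^ 2 - 1))) := by
    have hterm (k : ℕ) : d (2 * k) / q ^ (2 * k + 1) = a / q * ((q ^ 2)⁻¹) ^ k := by
      rw [hd0, pow_succ, pow_mul, inv_pow]
      field_simp
    simpa only [hterm] using hgeom.mul_left (a / q)
  have hodd : HasSum (fun k => d (2 * k + 1) / q ^ (2 * k + 1 + 1))
      (b / q ^ 2 * (q ^ 2 / (q ^ 2 - 1))) := by
    have hterm (k : ℕ) : d (2 * k + 1) / q ^ (2 * k + 1 + 1) = b / q ^ 2 * ((q ^ 2)⁻¹) ^ k := by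
      rw [hd1, add_assoc, pow_add, pow_mul, inv_pow]
      field_simp
    simpa only [hterm] using hgeom.mul_left (b / q ^ 2)
  have hval : (a * q + b) / (q ^ 2 - 1) =
      a / q * (q ^ 2 / (q ^ 2 - 1)) + b / q ^ 2 * (q ^ 2 / (q ^ 2 - 1)) := by
    field_simp
  rw [hval]
  exact HasSum.even_add_odd (f := fun i => d i / q ^ (i + 1)) heven hodd

/-- The value of an eventually periodic sequence with preperiod three and period two. -/
theorem seqVal_uwInf_three_two {q : ℝ} (hq : 1 < q) (u₀ u₁ u₂ a b : Fin 2) :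
    seqVal q (uwInf [u₀, u₁, u₂] [a, b]) =
      (u₀ : ℕ) / q + (u₁ : ℕ) / q ^ 2 + (u₂ : ℕ) / q ^ 3 +
        ((a : ℕ) * q + (b : ℕ)) / (q ^ 2 - 1) / q ^ 3 := by
  set ε := uwInf [u₀, u₁, u₂] [a, b] with hε
  have htail : HasSum (fun i => ((ε (i + 3) : ℕ) : ℝ) / q ^ (i + 3 + 1))
      (((a : ℕ) * q + (b : ℕ)) / (q ^ 2 - 1) / q ^ 3) := by
    have hterm (i : ℕ) : ((ε (i + 3) : ℕ) : ℝ) / q ^ (i + 3 + 1) =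
        ((ε (i + 3) : ℕ) : ℝ) / q ^ (i + 1) / q ^ 3 := by
      rw [div_div, ← pow_add, add_right_comm]
    simp only [hterm]
    exact (hasSum_digits_period_two hq (fun i => ((ε (i + 3) : ℕ) : ℝ)) (a : ℕ) (b : ℕ)
      (fun k => by simp [hε, uwInf])
      (fun k => by simp [hε, uwInf, Nat.add_mod])).div_const (q ^ 3)
  have hsum := (hasSum_nat_add_iff (f := fun i => ((ε i : ℕ) : ℝ) / q ^ (i + 1)) 3).1 htail
  rw [seqVal, hsum.tsum_eq]
  simp only [Finset.sum_range_succ, Finset.sum_range_zero, hε, uwInf]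
  simp
  ring

/-- For `q = q_{ℵ₀}`, `T_{q,0}((1+q³)/(q⁴−1)) = (111(10)^∞)_q` and
`T_{q,1}((q+q²)/(q⁴−1)) = (000(01)^∞)_q`. -/
theorem qAleph0_endpoint_images
    (qA : ℝ) (hqA1 : qA ∈ Set.Ioo (1 : ℝ) 2)
    (hqA2 : qA ^ 6 = qA ^ 4 + qA ^ 3 + 2 * qA ^ 2 + qA + 1) :
    Tmap qA 0 ((1 + qA ^ 3) / (qA ^ 4 - 1)) = seqVal qA (uwInf [1, 1, 1] [1, 0]) ∧
    Tmap qA 1 ((qA + qA ^ 2) / (qA ^ 4 - 1)) = seqVal qA (uwInf [0, 0, 0] [0, 1]) := by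
  have hq1 : 1 < qA := hqA1.1
  have hq0 : qA ≠ 0 := (zero_lt_one.trans hq1).ne'
  have hq2 : qA ^ 2 - 1 ≠ 0 := (sub_pos.2 (one_lt_pow₀ hq1 two_ne_zero)).ne'
  have hq2' : qA ^ 2 + 1 ≠ 0 := by positivity
  have hq4 : qA ^ 4 - 1 = (qA ^ 2 - 1) * (qA ^ 2 + 1) := by ring
  rw [seqVal_uwInf_three_two hq1, seqVal_uwInf_three_two hq1, hq4]
  constructor
  · simp only [Tmap, Fin.val_zero, Fin.val_one, Nat.cast_zero, Nat.cast_one]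
    field_simp
    linear_combination (qA - 1) * hqA2
  · simp only [Tmap, Fin.val_zero, Fin.val_one, Nat.cast_zero, Nat.cast_one]
    field_simp
    linear_combination -(qA - 1) * hqA2
end
end
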